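/- arXiv:1411.6796 — 2 statements merged into one kernel-verified Lean document; each statement's English description precedes it below -/
import Mathlib

section
/- Let f : ℂ → ℂ be an entire transcendental function (differentiable on all of ℂ and not a polynomial) and let n ≥ 2 be an integer. Then the set of repelling periodic points of f of minimal period n, i.e. {z : ℂ | f^[n] z = z ∧ (∀ j, 1 ≤ j → j < n → f^[j] z ≠ z) ∧ ‖deriv (f^[n]) z‖ > 1}, is infinite. -/
section

open Set Filter Topology Metric Complex

/-- A holomorphic function without zeros on a disc has holomorphic roots there. -/
theorem exists_root_on_ball {g : ℂ → ℂ} {c : ℂ} {r : ℝ} (hg : DifferentiableOn ℂ g (ball c r))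
    (h0 : ∀ z ∈ ball c r, g z ≠ 0) {p : ℕ} (hp : p ≠ 0) :
    ∃ ξ : ℂ → ℂ, DifferentiableOn ℂ ξ (ball c r) ∧ ∀ z ∈ ball c r, ξ z ^ p = g z := by
  rcases le_or_gt r 0 with hr | hr
  · exact ⟨0, by simp [ball_eq_empty.2 hr], by simp [ball_eq_empty.2 hr]⟩
  have hcc : c ∈ ball c r := mem_ball_self hr
  have hd : DifferentiableOn ℂ (deriv g) (ball c r) := hg.deriv isOpen_ball
  obtain ⟨F, hF⟩ := ((hd.div hg h0).isExactOn_ball)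
  have hF : ∀ z ∈ ball c r, HasDerivAt F (deriv g z / g z) z := hF
  have hconst : ∀ z ∈ ball c r, g z * exp (-F z) = g c * exp (-F c) := by
    intro z hz
    have hder : ∀ w ∈ ball c r, HasDerivAt (fun w => g w * exp (-F w)) 0 w := by
      intro w hw
      have h1 := (hg.differentiableAt (isOpen_ball.mem_nhds hw)).hasDerivAt
      have h2 := (hF w hw).neg.cexp
      refine (h1.fun_mul h2).congr_deriv ?_
      have := h0 w hw
      field_simp
      ring
    refine (convex_ball c r).is_const_of_fderivWithin_eq_zero (𝕜 := ℂ)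
      (f := fun w => g w * exp (-F w))
      (fun w hw => (hder w hw).differentiableAt.differentiableWithinAt) ?_ hz hcc
    intro w hw
    rw [fderivWithin_of_isOpen isOpen_ball hw]
    ext
    simp [(hder w hw).deriv]
  obtain ⟨a, ha⟩ := IsAlgClosed.exists_pow_nat_eq (g c * exp (-F c)) (Nat.pos_of_ne_zero hp)
  refine ⟨fun z => a * exp (F z / p), ?_, ?_⟩
  · intro z hz
    have h := (hF z hz).differentiableAt
    exact (((h.div_const _).cexp).const_mul a).differentiableWithinAt
  · intro z hz
    have h := hconst z hz
    simp only
    rw [mul_pow, ha, ← h, ← exp_nat_mul, mul_div_cancel₀ _ (Nat.cast_ne_zero.2 hp), mul_assoc,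
      ← exp_add]
    simp

/-- The derivative bound replacing a bound on the spherical derivative. -/
def GrowthBound (C : ℝ) (Φ : ℂ → ℂ) (z : ℂ) : Prop :=
  ‖deriv Φ z‖ ^ 4 ≤ C * (1 + ‖Φ z‖) ^ 5

theorem norm_le_of_growthBound (A B C : ℝ) (hA : 0 ≤ A) (hAB : A < B) :
    ∃ c > 0, ∀ (Φ : ℂ → ℂ) (s : Set ℂ), Convex ℝ s → IsOpen s → DifferentiableOn ℂ Φ s →
      (∀ z ∈ s, GrowthBound C Φ z) → ∀ z ∈ s, ∀ z' ∈ s, ‖Φ z‖ ≤ A → dist z' z ≤ c →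
        ‖Φ z'‖ ≤ B := by
  set C' : ℝ := |C| * (1 + B) ^ 5 + 1 with hC'
  have hB : 0 < B := hA.trans_lt hAB
  have hC1 : 1 ≤ C' := by rw [hC']; have : 0 ≤ |C| * (1 + B) ^ 5 := by positivity
                          linarith
  refine ⟨(B - A) / (2 * C'), div_pos (by linarith) (by linarith), ?_⟩
  intro Φ s hs ho hd hb z hz z' hz' hzA hdist
  have hseg : ∀ t ∈ Icc (0 : ℝ) 1, z + (t : ℂ) * (z' - z) ∈ s := by
    intro t ht
    have := hs.add_smul_sub_mem hz hz' ht
    simpa using this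
  have hder : ∀ t ∈ Icc (0 : ℝ) 1, HasDerivAt (fun t : ℝ => Φ (z + (t : ℂ) * (z' - z)))
      (deriv Φ (z + (t : ℂ) * (z' - z)) * (z' - z)) t := by
    intro t ht
    have h1 := (hd.differentiableAt (ho.mem_nhds (hseg t ht))).hasDerivAt
    have h2 : HasDerivAt (fun t : ℝ => z + (t : ℂ) * (z' - z)) (1 * (z' - z)) t :=
      ((Complex.ofRealCLM.hasDerivAt (x := t)).mul_const (z' - z)).const_add z
    have := h1.comp_of_eq t h2 rfl
    simpa [Function.comp_def] using this
  have key := image_norm_le_of_norm_deriv_right_lt_deriv_boundary' (a := 0) (b := 1)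
    (f := fun t : ℝ => Φ (z + (t : ℂ) * (z' - z)))
    (f' := fun t : ℝ => deriv Φ (z + (t : ℂ) * (z' - z)) * (z' - z))
    (fun t ht => (hder t ht).continuousAt.continuousWithinAt)
    (fun t ht => (hder t (Ico_subset_Icc_self ht)).hasDerivWithinAt)
    (B := fun t => A + (B - A) * t) (B' := fun _ => B - A) (by simpa using hzA)
    (by fun_prop)
    (fun t _ => by
      have := ((hasDerivAt_id t).const_mul (B - A)).const_add A
      simpa using this.hasDerivWithinAt)
    (fun t ht heq => by
      have ht' := Ico_subset_Icc_self ht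
      have h1 := hb _ (hseg t ht')
      have h2 : ‖Φ (z + (t : ℂ) * (z' - z))‖ ≤ B := by
        rw [heq]; nlinarith [ht'.2]
      have h3 : ‖deriv Φ (z + (t : ℂ) * (z' - z))‖ ≤ C' := by
        by_contra! hlt
        have h4 : C' ≤ C' ^ 4 := le_self_pow₀ hC1 (by norm_num)
        have h5 : C' ^ 4 ≤ ‖deriv Φ (z + (t : ℂ) * (z' - z))‖ ^ 4 := by gcongr
        have h6 : C * (1 + ‖Φ (z + (t : ℂ) * (z' - z))‖) ^ 5 ≤ |C| * (1 + B) ^ 5 := by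
          gcongr; exact le_abs_self C
        unfold GrowthBound at h1
        linarith
      rw [norm_mul]
      rw [dist_eq_norm] at hdist
      calc _ ≤ C' * ((B - A) / (2 * C')) := by gcongr
        _ = (B - A) / 2 := by field_simp
        _ < B - A := by linarith)
    (right_mem_Icc.2 zero_le_one)
  simpa using key

theorem one_le_norm_of_growthBound (C δ : ℝ) (hδ : 0 < δ) :
    ∃ c > 0, c ≤ δ ∧ ∀ (Φ : ℂ → ℂ) (z : ℂ), DifferentiableOn ℂ Φ (ball z δ) →
      (∀ w ∈ ball z δ, GrowthBound C Φ w) → 2 ≤ ‖Φ z‖ → ∀ w ∈ ball z c, 1 ≤ ‖Φ w‖ := by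
  obtain ⟨c, hc, h⟩ := norm_le_of_growthBound 1 (3 / 2) C zero_le_one (by norm_num)
  refine ⟨min c δ, lt_min hc hδ, min_le_right _ _, ?_⟩
  intro Φ z hd hb h2 w hw
  by_contra! hlt
  have hw1 : dist z w ≤ c := by
    rw [dist_comm]; exact (mem_ball.1 hw).le.trans (min_le_left _ _)
  have := h Φ _ (convex_ball z δ) isOpen_ball hd hb w (ball_subset_ball (min_le_right _ _) hw) z
    (mem_ball_self hδ) hlt.le hw1
  linarith

theorem exists_inv_root {Φ : ℂ → ℂ} {z : ℂ} {c : ℝ} (hd : DifferentiableOn ℂ Φ (ball z c))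
    (h1 : ∀ w ∈ ball z c, 1 ≤ ‖Φ w‖) {p : ℕ} (hp : p ≠ 0) :
    ∃ ξ : ℂ → ℂ, DifferentiableOn ℂ ξ (ball z c) ∧ (∀ w ∈ ball z c, ξ w ^ p * Φ w = 1) ∧
      (∀ w ∈ ball z c, ‖ξ w‖ ≤ 1) := by
  have h0 : ∀ w ∈ ball z c, Φ w ≠ 0 := fun w hw h => by
    have := h1 w hw
    rw [h, norm_zero] at this; linarith
  obtain ⟨ξ, hξ, h⟩ := exists_root_on_ball (g := fun w => (Φ w)⁻¹) (hd.inv h0)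
    (fun w hw => inv_ne_zero (h0 w hw)) hp
  refine ⟨ξ, hξ, fun w hw => by rw [h w hw, inv_mul_cancel₀ (h0 w hw)], fun w hw => ?_⟩
  have : ‖ξ w‖ ^ p ≤ 1 := by
    rw [← norm_pow, h w hw, norm_inv]
    exact inv_le_one_of_one_le₀ (h1 w hw)
  exact (pow_le_one_iff_of_nonneg (norm_nonneg _) hp).1 this

theorem norm_gt_of_growthBound (C δ : ℝ) (hδ : 0 < δ) :
    ∃ c > 0, c ≤ δ ∧ ∀ K : ℝ, ∃ K' : ℝ, ∀ (Φ : ℂ → ℂ) (z : ℂ), DifferentiableOn ℂ Φ (ball z δ) →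
      (∀ w ∈ ball z δ, GrowthBound C Φ w) → K' ≤ ‖Φ z‖ → ∀ w ∈ ball z c, K < ‖Φ w‖ := by
  obtain ⟨c, hc, hcδ, h⟩ := one_le_norm_of_growthBound C δ hδ
  refine ⟨c / 12, by positivity, by linarith, fun K => ?_⟩
  obtain ⟨p, hp⟩ := pow_unbounded_of_one_lt (max K 1) (one_lt_two (α := ℝ))
  have hp0 : p ≠ 0 := by
    rintro rfl
    have := (le_max_right K 1).trans_lt hp
    norm_num at this
  refine ⟨4 ^ p + 2, fun Φ z hd hb hK w hw => ?_⟩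
  have hsub := ball_subset_ball hcδ (x := z)
  have h1 := h Φ z hd hb (le_trans (by have : (0:ℝ) < 4 ^ p := by positivity
                                       linarith) hK)
  obtain ⟨ξ, hξ, hξ1, hξ2⟩ := exists_inv_root (hd.mono hsub) h1 hp0
  have hzz := mem_ball_self (x := z) hc
  have hwc : w ∈ ball z c := ball_subset_ball (by linarith) hw
  have hmaps : MapsTo ξ (ball z c) (ball (ξ z) 3) := by
    intro v hv
    rw [mem_ball, dist_eq_norm]
    have := norm_sub_le (ξ v) (ξ z)
    linarith [hξ2 v hv, hξ2 z hzz]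
  have hs := Complex.dist_le_div_mul_dist_of_mapsTo_ball hξ
    (hmaps.mono_right ball_subset_closedBall) hwc
  have hs' : dist (ξ w) (ξ z) ≤ 1 / 4 := by
    refine hs.trans ?_
    calc 3 / c * dist w z ≤ 3 / c * (c / 12) := by gcongr; exact (mem_ball.1 hw).le
      _ = 1 / 4 := by field_simp; norm_num
  have hzq : ‖ξ z‖ ≤ 1 / 4 := by
    by_contra! hlt
    have h4 : (1 / 4 : ℝ) ^ p < ‖ξ z‖ ^ p := pow_lt_pow_left₀ hlt (by norm_num) hp0
    have h5 : ‖ξ z‖ ^ p * ‖Φ z‖ = 1 := by rw [← norm_pow, ← norm_mul, hξ1 z hzz, norm_one]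
    have h6 : (1 / 4 : ℝ) ^ p * 4 ^ p = 1 := by rw [← mul_pow]; norm_num
    have h7 : (4 : ℝ) ^ p ≤ ‖Φ z‖ := by linarith
    have h8 : (1 / 4 : ℝ) ^ p * 4 ^ p < ‖ξ z‖ ^ p * ‖Φ z‖ :=
      mul_lt_mul h4 h7 (by positivity) (by positivity)
    linarith
  have hwq : ‖ξ w‖ ≤ 1 / 2 := by
    rw [dist_eq_norm] at hs'
    have := norm_le_norm_add_norm_sub' (ξ w) (ξ z)
    linarith
  have h5 : ‖ξ w‖ ^ p * ‖Φ w‖ = 1 := by rw [← norm_pow, ← norm_mul, hξ1 w hwc, norm_one]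
  have h6 : (1 / 2 : ℝ) ^ p * 2 ^ p = 1 := by rw [← mul_pow]; norm_num
  have h7 : ‖ξ w‖ ^ p ≤ (1 / 2) ^ p := by gcongr
  have h8 : (2 : ℝ) ^ p ≤ ‖Φ w‖ := by
    by_contra! hlt
    have : ‖ξ w‖ ^ p * ‖Φ w‖ < (1 / 2) ^ p * 2 ^ p :=
      mul_lt_mul' h7 hlt (norm_nonneg _) (by positivity)
    linarith
  exact (le_max_left K 1).trans_lt (hp.trans_le h8)

theorem norm_le_of_growthBound_of_eq :
    ∃ K : ℝ, ∀ g : ℂ → ℂ, DifferentiableOn ℂ g (ball 0 1) → (∀ w ∈ ball 0 1, GrowthBound 16 g w) →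
      (1 + ‖g 0‖) ^ 5 ≤ ‖deriv g 0‖ ^ 4 → ‖g 0‖ ≤ K := by
  obtain ⟨c, hc, hcδ, h⟩ := one_le_norm_of_growthBound 16 1 one_pos
  refine ⟨max 2 ((24 / c) ^ 8), fun g hd hb hg => ?_⟩
  rcases lt_or_ge ‖g 0‖ 2 with h2 | h2
  · exact h2.le.trans (le_max_left _ _)
  refine le_trans ?_ (le_max_right _ _)
  have h1 := h g 0 hd hb h2
  have hsub := ball_subset_ball hcδ (x := (0 : ℂ))
  obtain ⟨ξ, hξ, hξ1, hξ2⟩ := exists_inv_root (hd.mono hsub) h1 (p := 8) (by norm_num)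
  have hzz := mem_ball_self (x := (0 : ℂ)) hc
  have hmaps : MapsTo ξ (ball 0 c) (ball (ξ 0) 3) := by
    intro v hv
    rw [mem_ball, dist_eq_norm]
    have := norm_sub_le (ξ v) (ξ 0)
    linarith [hξ2 v hv, hξ2 0 hzz]
  have hs := Complex.norm_deriv_le_div_of_mapsTo_ball hξ
    (hmaps.mono_right ball_subset_closedBall) hc
  have e1 : HasDerivAt (fun w => ξ w ^ 8 * g w)
      (8 * ξ 0 ^ 7 * deriv ξ 0 * g 0 + ξ 0 ^ 8 * deriv g 0) 0 := by
    have h1 := (hξ.differentiableAt (isOpen_ball.mem_nhds hzz)).hasDerivAt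
    have h2 := (hd.differentiableAt (isOpen_ball.mem_nhds (hsub hzz))).hasDerivAt
    simpa using (h1.fun_pow 8).fun_mul h2
  have e2 : HasDerivAt (fun w => ξ w ^ 8 * g w) 0 0 := by
    refine (hasDerivAt_const (0 : ℂ) (1 : ℂ)).congr_of_eventuallyEq ?_
    filter_upwards [isOpen_ball.mem_nhds hzz] with w hw using hξ1 w hw
  have e3 := e1.unique e2
  have h00 := hξ1 0 hzz
  have hξ0 : ξ 0 ≠ 0 := by
    rintro h; rw [h] at h00; norm_num at h00
  have e4 : ξ 0 * deriv g 0 = -8 * deriv ξ 0 * g 0 := by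
    have : ξ 0 ^ 7 * (ξ 0 * deriv g 0 - -8 * deriv ξ 0 * g 0) = 0 := by linear_combination e3
    have := (mul_eq_zero.1 this).resolve_left (pow_ne_zero _ hξ0)
    exact sub_eq_zero.1 this
  have n1 : ‖ξ 0‖ * ‖deriv g 0‖ = 8 * ‖deriv ξ 0‖ * ‖g 0‖ := by
    have := congrArg norm e4
    simpa using this
  have n2 : ‖ξ 0‖ ^ 8 * ‖g 0‖ = 1 := by
    have := congrArg norm h00
    simpa using this
  set x := ‖ξ 0‖
  set G := ‖g 0‖
  set y := ‖deriv ξ 0‖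
  have hG : 0 < G := by linarith
  have n3 : x ^ 4 * G ^ 5 ≤ (8 * y) ^ 4 * G ^ 4 := by
    rw [← mul_pow, ← n1, mul_pow]
    gcongr
    refine le_trans ?_ hg
    gcongr
    linarith
  have n4 : x ^ 4 * G ≤ (8 * y) ^ 4 := by
    have : x ^ 4 * G * G ^ 4 ≤ (8 * y) ^ 4 * G ^ 4 := by linarith
    exact le_of_mul_le_mul_right this (by positivity)
  have n5 : G ≤ (8 * y) ^ 8 := by
    calc G = (x ^ 8 * G) * G := by rw [n2, one_mul]
      _ = (x ^ 4 * G) ^ 2 := by ring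
      _ ≤ ((8 * y) ^ 4) ^ 2 := by gcongr
      _ = _ := by ring
  refine n5.trans ?_
  gcongr
  calc 8 * y ≤ 8 * (3 / c) := by gcongr
    _ = 24 / c := by ring

/-- Eventual local boundedness of a family of holomorphic functions near `z`. -/
def LocBdd {ι : Type*} (l : Filter ι) (Φ : ι → ℂ → ℂ) (z : ℂ) : Prop :=
  ∃ ε > 0, ∃ K : ℝ, ∀ᶠ i in l, DifferentiableOn ℂ (Φ i) (ball z ε) ∧ ∀ w ∈ ball z ε, ‖Φ i w‖ ≤ K

/-- Eventual local growth bound of a family of holomorphic functions near `z`. -/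
def Tame {ι : Type*} (l : Filter ι) (Φ : ι → ℂ → ℂ) (z : ℂ) : Prop :=
  ∃ ε > 0, ∃ C : ℝ, ∀ᶠ i in l, DifferentiableOn ℂ (Φ i) (ball z ε) ∧
    ∀ w ∈ ball z ε, GrowthBound C (Φ i) w

/-- Uniform convergence of holomorphic functions near `z`. -/
def LocUnif {ι : Type*} (l : Filter ι) (Φ : ι → ℂ → ℂ) (g : ℂ → ℂ) (z : ℂ) : Prop :=
  ∃ ε > 0, (∀ᶠ i in l, DifferentiableOn ℂ (Φ i) (ball z ε)) ∧ TendstoUniformlyOn Φ g l (ball z ε)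

theorem Tame.escape {ι : Type*} {l : Filter ι} {Φ : ι → ℂ → ℂ} {z : ℂ} (h : Tame l Φ z)
    (hz : ∀ K : ℝ, ∀ᶠ i in l, K < ‖Φ i z‖) :
    ∃ ε > 0, ∀ K : ℝ, ∀ᶠ i in l, ∀ w ∈ ball z ε, K < ‖Φ i w‖ := by
  obtain ⟨δ, hδ, C, h⟩ := h
  obtain ⟨c, hc, -, hQ⟩ := norm_gt_of_growthBound C δ hδ
  refine ⟨c, hc, fun K => ?_⟩
  obtain ⟨K', hK'⟩ := hQ K
  filter_upwards [h, hz K'] with i hi hi'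
  exact hK' _ _ hi.1 hi.2 hi'.le

theorem Tame.locBdd {ι : Type*} {l : Filter ι} {Φ : ι → ℂ → ℂ} {z : ℂ} (h : Tame l Φ z)
    {K : ℝ} (hz : ∀ᶠ i in l, ‖Φ i z‖ ≤ K) : LocBdd l Φ z := by
  obtain ⟨δ, hδ, C, h⟩ := h
  obtain ⟨c, hc, hQ⟩ := norm_le_of_growthBound (max K 0) (max K 0 + 1) C (le_max_right _ _)
    (by linarith)
  refine ⟨min c δ, lt_min hc hδ, max K 0 + 1, ?_⟩
  filter_upwards [h, hz] with i hi hi'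
  have hsub : ball z (min c δ) ⊆ ball z δ := ball_subset_ball (min_le_right _ _)
  refine ⟨hi.1.mono hsub, fun w hw => ?_⟩
  exact hQ _ _ (convex_ball z δ) isOpen_ball hi.1 hi.2 z (mem_ball_self hδ) w (hsub hw)
    (hi'.trans (le_max_left _ _)) ((mem_ball.1 hw).le.trans (min_le_left _ _))

theorem LocBdd.of_preconnected {ι : Type*} {U : Ultrafilter ι} {Φ : ι → ℂ → ℂ} {D : Set ℂ}
    (hD : IsPreconnected D) (hT : ∀ z ∈ D, Tame U Φ z) {z₀ : ℂ} (hz₀ : z₀ ∈ D) {K : ℝ}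
    (hK : ∀ᶠ i in (U : Filter ι), ‖Φ i z₀‖ ≤ K) : ∀ z ∈ D, LocBdd U Φ z := by
  set A : Set ℂ := {z | ∃ ε > 0, ∃ K : ℝ, ∀ᶠ i in (U : Filter ι), ∀ w ∈ ball z ε, ‖Φ i w‖ ≤ K}
  set B : Set ℂ := {z | ∃ ε > 0, ∀ K : ℝ, ∀ᶠ i in (U : Filter ι), ∀ w ∈ ball z ε, K < ‖Φ i w‖}
  have hAo : IsOpen A := by
    rw [Metric.isOpen_iff]
    rintro z ⟨ε, hε, K, h⟩
    refine ⟨ε / 2, by positivity, fun w hw => ⟨ε / 2, by positivity, K, ?_⟩⟩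
    filter_upwards [h] with i hi v hv
    exact hi v (by rw [mem_ball] at *; linarith [dist_triangle v w z])
  have hBo : IsOpen B := by
    rw [Metric.isOpen_iff]
    rintro z ⟨ε, hε, h⟩
    refine ⟨ε / 2, by positivity, fun w hw => ⟨ε / 2, by positivity, fun K => ?_⟩⟩
    filter_upwards [h K] with i hi v hv
    exact hi v (by rw [mem_ball] at *; linarith [dist_triangle v w z])
  have hdis : Disjoint A B := by
    rw [Set.disjoint_left]
    rintro z ⟨ε, hε, K, h⟩ ⟨ε', hε', h'⟩
    obtain ⟨i, hi, hi'⟩ := (h.and (h' K)).exists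
    exact absurd (hi z (mem_ball_self hε)) (not_le.2 (hi' z (mem_ball_self hε')))
  have hcov : D ⊆ A ∪ B := by
    intro z hz
    by_cases hb : ∃ K : ℝ, ∀ᶠ i in (U : Filter ι), ‖Φ i z‖ ≤ K
    · obtain ⟨K, hK⟩ := hb
      obtain ⟨ε, hε, K, h⟩ := (hT z hz).locBdd hK
      exact Or.inl ⟨ε, hε, K, h.mono fun i hi => hi.2⟩
    · right
      push Not at hb
      refine (hT z hz).escape fun K => ?_
      exact hb K
  have hsub : D ⊆ A := by
    refine hD.subset_left_of_subset_union hAo hBo hdis hcov ⟨z₀, hz₀, ?_⟩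
    obtain ⟨ε, hε, K, h⟩ := (hT z₀ hz₀).locBdd hK
    exact ⟨ε, hε, K, h.mono fun i hi => hi.2⟩
  intro z hz
  obtain ⟨ε, hε, K, h⟩ := hsub hz
  exact (hT z hz).locBdd (h.mono fun i hi => hi z (mem_ball_self hε))

theorem lipschitz_of_bound {Φ : ℂ → ℂ} {z : ℂ} {ε K : ℝ} (hε : 0 < ε)
    (hd : DifferentiableOn ℂ Φ (ball z ε)) (hK : ∀ w ∈ ball z ε, ‖Φ w‖ ≤ K) {v w : ℂ}
    (hv : v ∈ ball z (ε / 4)) (hw : w ∈ ball z (ε / 4)) :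
    dist (Φ v) (Φ w) ≤ 4 * (K + 1) / ε * dist v w := by
  have hsub : ball w (ε / 2) ⊆ ball z ε := by
    intro u hu
    rw [mem_ball] at *
    linarith [dist_triangle u w z]
  have hwb : w ∈ ball z ε := ball_subset_ball (by linarith) hw
  have hmaps : MapsTo Φ (ball w (ε / 2)) (closedBall (Φ w) (2 * (K + 1))) := by
    intro u hu
    rw [mem_closedBall, dist_eq_norm]
    linarith [norm_sub_le (Φ u) (Φ w), hK u (hsub hu), hK w hwb]
  have hvw : v ∈ ball w (ε / 2) := by
    rw [mem_ball] at *
    linarith [dist_triangle_right v w z]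
  have := Complex.dist_le_div_mul_dist_of_mapsTo_ball (hd.mono hsub) hmaps hvw
  refine this.trans_eq ?_
  field_simp
  ring

theorem LocBdd.exists_limit {ι : Type*} {U : Ultrafilter ι} {Φ : ι → ℂ → ℂ} :
    ∃ g : ℂ → ℂ, ∀ z, LocBdd U Φ z → LocUnif U Φ g z := by
  have hlim : ∀ z, ∃ y, LocBdd U Φ z → Tendsto (fun i => Φ i z) U (𝓝 y) := by
    intro z
    by_cases hz : LocBdd U Φ z
    · obtain ⟨ε, hε, K, h⟩ := hz
      have h1 : ∀ᶠ i in (U : Filter ι), Φ i z ∈ closedBall (0 : ℂ) K := by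
        filter_upwards [h] with i hi
        simpa using hi.2 z (mem_ball_self hε)
      obtain ⟨y, -, hy⟩ := (isCompact_closedBall (0 : ℂ) K).ultrafilter_le_nhds'
        (U.map fun i => Φ i z) h1
      exact ⟨y, fun _ => hy⟩
    · exact ⟨0, fun h => absurd h hz⟩
  choose g hg using hlim
  refine ⟨g, fun z hz => ?_⟩
  obtain ⟨ε, hε, K, h⟩ := hz
  have hbd : ∀ w ∈ ball z (ε / 2), LocBdd U Φ w := by
    intro w hw
    have hsub : ball w (ε / 2) ⊆ ball z ε := by
      intro u hu
      rw [mem_ball] at *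
      linarith [dist_triangle u w z]
    exact ⟨ε / 2, by positivity, K, h.mono fun i hi =>
      ⟨hi.1.mono hsub, fun u hu => hi.2 u (hsub hu)⟩⟩
  refine ⟨ε / 8, by positivity, h.mono fun i hi => hi.1.mono (ball_subset_ball (by linarith)), ?_⟩
  set L := 4 * (|K| + 1) / ε with hL
  have hL0 : 0 < L := by positivity
  have hlip : ∀ᶠ i in (U : Filter ι), ∀ v ∈ ball z (ε / 4), ∀ w ∈ ball z (ε / 4),
      dist (Φ i v) (Φ i w) ≤ L * dist v w := by
    filter_upwards [h] with i hi v hv w hw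
    exact lipschitz_of_bound hε hi.1 (fun u hu => (hi.2 u hu).trans (le_abs_self K)) hv hw
  have hglip : ∀ v ∈ ball z (ε / 4), ∀ w ∈ ball z (ε / 4), dist (g v) (g w) ≤ L * dist v w := by
    intro v hv w hw
    have h1 := hg v (hbd v (ball_subset_ball (by linarith) hv))
    have h2 := hg w (hbd w (ball_subset_ball (by linarith) hw))
    refine le_of_tendsto (h1.dist h2) ?_
    filter_upwards [hlip] with i hi using hi v hv w hw
  rw [Metric.tendstoUniformlyOn_iff]
  intro η hη
  obtain ⟨t, htsub, htfin, htcov⟩ := (isCompact_closedBall z (ε / 8)).finite_cover_balls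
    (e := η / (3 * L)) (by positivity)
  have hmem : ∀ v ∈ closedBall z (ε / 8), v ∈ ball z (ε / 4) := fun v hv =>
    closedBall_subset_ball (by linarith) hv
  have hfin : ∀ᶠ i in (U : Filter ι), ∀ v ∈ t, dist (g v) (Φ i v) < η / 3 := by
    rw [htfin.eventually_all]
    intro v hv
    have h1 := hg v (hbd v (ball_subset_ball (by linarith) (hmem v (htsub hv))))
    have := (Metric.tendsto_nhds.1 h1) (η / 3) (by positivity)
    filter_upwards [this] with i hi
    rwa [dist_comm]
  filter_upwards [hlip, hfin] with i hi hi' w hw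
  have hw' := htcov (ball_subset_closedBall hw)
  simp only [mem_iUnion, mem_ball, exists_prop] at hw'
  obtain ⟨v, hv, hvw⟩ := hw'
  have hwm := hmem w (ball_subset_closedBall hw)
  have hvm := hmem v (htsub hv)
  have e1 := hglip w hwm v hvm
  have e2 := hi v hvm w hwm
  have e3 := hi' v hv
  have e4 : L * dist w v < η / 3 := by
    calc L * dist w v < L * (η / (3 * L)) := by gcongr
      _ = η / 3 := by field_simp
  rw [dist_comm v w] at e2
  have e5 := dist_triangle4 (g w) (g v) (Φ i v) (Φ i w)
  linarith

section
variable {ι : Type*} {l : Filter ι} {Φ : ι → ℂ → ℂ} {g : ℂ → ℂ} {z : ℂ}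

theorem LocUnif.tendsto (h : LocUnif l Φ g z) : Tendsto (fun i => Φ i z) l (𝓝 (g z)) := by
  obtain ⟨ε, hε, -, h⟩ := h
  exact h.tendsto_at (mem_ball_self hε)

theorem LocUnif.differentiableOn [l.NeBot] (h : LocUnif l Φ g z) :
    ∃ ε > 0, DifferentiableOn ℂ g (ball z ε) := by
  obtain ⟨ε, hε, hd, h⟩ := h
  exact ⟨ε, hε, h.tendstoLocallyUniformlyOn.differentiableOn hd isOpen_ball⟩

theorem LocUnif.differentiableAt [l.NeBot] (h : LocUnif l Φ g z) : DifferentiableAt ℂ g z := by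
  obtain ⟨ε, hε, h⟩ := h.differentiableOn
  exact h.differentiableAt (ball_mem_nhds z hε)

theorem LocUnif.deriv [l.NeBot] (h : LocUnif l Φ g z) :
    LocUnif l (fun i => deriv (Φ i)) (deriv g) z := by
  obtain ⟨ε, hε, hd, h⟩ := h
  have h1 := h.tendstoLocallyUniformlyOn.deriv hd isOpen_ball
  refine ⟨ε / 2, by positivity, ?_, ?_⟩
  · filter_upwards [hd] with i hi
    exact (hi.deriv isOpen_ball).mono (ball_subset_ball (by linarith))
  · have h2 := (tendstoLocallyUniformlyOn_iff_forall_isCompact isOpen_ball).1 h1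
      (closedBall z (ε / 2)) (closedBall_subset_ball (by linarith)) (isCompact_closedBall _ _)
    exact h2.mono ball_subset_closedBall

theorem LocUnif.tendsto_comp [l.NeBot] (h : LocUnif l Φ g z) {w : ι → ℂ}
    (hw : Tendsto w l (𝓝 z)) : Tendsto (fun i => Φ i (w i)) l (𝓝 (g z)) := by
  have hc := h.differentiableAt.continuousAt
  obtain ⟨ε, hε, -, h⟩ := h
  have h1 : Tendsto (fun i => g (w i)) l (𝓝 (g z)) := hc.tendsto.comp hw
  rw [Metric.tendsto_nhds] at h1 ⊢
  rw [Metric.tendstoUniformlyOn_iff] at h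
  intro η hη
  filter_upwards [h1 (η / 2) (by positivity), h (η / 2) (by positivity),
    hw (ball_mem_nhds z hε)] with i a b c
  have := b _ c
  linarith [dist_triangle_left (Φ i (w i)) (g z) (g (w i))]

theorem LocUnif.iteratedDeriv [l.NeBot] (h : LocUnif l Φ g z) (n : ℕ) :
    LocUnif l (fun i => iteratedDeriv n (Φ i)) (iteratedDeriv n g) z := by
  induction n with
  | zero => simpa [iteratedDeriv_zero] using h
  | succ n ih => simpa only [iteratedDeriv_succ] using ih.deriv

end

/-- A quantitative local right inverse at a noncritical point. -/
theorem exists_local_right_inverse (M t : ℝ) (ht : 0 < t) :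
    ∃ c > 0, ∀ (p : ℂ → ℂ) (z : ℂ), DifferentiableOn ℂ p (ball z t) →
      (∀ w ∈ ball z t, ‖p w‖ ≤ M) → deriv p z ≠ 0 →
      ∃ h : ℂ → ℂ, DifferentiableOn ℂ h (ball (p z) (c * ‖deriv p z‖ ^ 2)) ∧
        ∀ w ∈ ball (p z) (c * ‖deriv p z‖ ^ 2), h w ∈ ball z t ∧ p (h w) = w := by
  set A : ℝ := 4 * (|M| + 1) / t with hA
  have hA0 : 0 < A := by positivity
  set L : ℝ := 4 * (A + 1) / (t / 2) with hL
  have hL0 : 0 < L := by positivity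
  set κ : ℝ := min (t / (16 * (A + 1))) (1 / (2 * L)) with hκ
  have hκ0 : 0 < κ := lt_min (by positivity) (by positivity)
  refine ⟨κ / 4, by positivity, ?_⟩
  intro p z hd hM hα
  set α := deriv p z with hαd
  have hα0 : 0 < ‖α‖ := norm_pos_iff.2 hα
  have hderb : ∀ w ∈ ball z (t / 2), ‖deriv p w‖ ≤ A := by
    intro w hw
    have hsub : ball w (t / 2) ⊆ ball z t := by
      intro u hu
      rw [mem_ball] at *
      linarith [dist_triangle u w z]
    have hmaps : MapsTo p (ball w (t / 2)) (closedBall (p w) (2 * (|M| + 1))) := by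
      intro u hu
      rw [mem_closedBall, dist_eq_norm]
      linarith [norm_sub_le (p u) (p w), hM u (hsub hu),
        hM w (hsub (mem_ball_self (by positivity))),
        le_abs_self M]
    refine (Complex.norm_deriv_le_div_of_mapsTo_ball (hd.mono hsub) hmaps
      (by positivity)).trans_eq ?_
    rw [hA]; field_simp; ring
  have hdd : DifferentiableOn ℂ (deriv p) (ball z (t / 2)) :=
    (hd.deriv isOpen_ball).mono (ball_subset_ball (by linarith))
  have hlip : ∀ v ∈ ball z (t / 8), dist (deriv p v) α ≤ L * dist v z := by
    intro v hv
    exact lipschitz_of_bound (by positivity) hdd hderb (by convert hv using 2; ring)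
      (mem_ball_self (by positivity))
  have hαA : ‖α‖ ≤ A := hderb z (mem_ball_self (by positivity))
  set r := κ * ‖α‖ with hr
  have hr0 : 0 < r := by positivity
  have hrt : r < t / 8 := by
    calc κ * ‖α‖ ≤ t / (16 * (A + 1)) * A := by
          gcongr; exact min_le_left _ _
      _ < t / 8 := by
        rw [div_mul_eq_mul_div, div_lt_div_iff₀ (by positivity) (by positivity)]
        nlinarith
  have hrL : L * r ≤ ‖α‖ / 2 := by
    calc L * (κ * ‖α‖) ≤ L * (1 / (2 * L) * ‖α‖) := by
          gcongr; exact min_le_right _ _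
      _ = ‖α‖ / 2 := by field_simp
  have hsub : closedBall z r ⊆ ball z (t / 8) := closedBall_subset_ball hrt
  have hsubt : ball z (t / 8) ⊆ ball z t := ball_subset_ball (by linarith)
  have hclose : ∀ v ∈ closedBall z r, ‖deriv p v - α‖ ≤ ‖α‖ / 2 := by
    intro v hv
    rw [← dist_eq_norm]
    refine (hlip v (hsub hv)).trans (le_trans ?_ hrL)
    gcongr
    exact hv
  have hexp : ∀ v ∈ closedBall z r, ∀ w ∈ closedBall z r, ‖α‖ / 2 * ‖v - w‖ ≤ ‖p v - p w‖ := by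
    intro v hv w hw
    have hh : ∀ x ∈ closedBall z r, HasDerivWithinAt (fun x => p x - α * x) (deriv p x - α)
        (closedBall z r) x := by
      intro x hx
      have h1 := (hd.differentiableAt (isOpen_ball.mem_nhds (hsubt (hsub hx)))).hasDerivAt
      have h2 := (hasDerivAt_id x).const_mul α
      exact ((h1.sub h2).congr_deriv (by simp)).hasDerivWithinAt
    have h3 := (convex_closedBall z r).norm_image_sub_le_of_norm_hasDerivWithin_le hh hclose hw hv
    have h4 : α * (v - w) = (p v - p w) - (p v - α * v - (p w - α * w)) := by ring
    have h5 : ‖α‖ * ‖v - w‖ ≤ ‖p v - p w‖ + ‖p v - α * v - (p w - α * w)‖ := by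
      rw [← norm_mul, h4]
      exact norm_sub_le _ _
    linarith
  have hdc : DiffContOnCl ℂ p (ball z r) := by
    refine (hd.mono ?_).diffContOnCl
    exact (closure_ball_subset_closedBall.trans hsub).trans hsubt
  have hsurj := hdc.ball_subset_image_closedBall (ε := ‖α‖ / 2 * r) hr0 (fun w hw => by
      have hw' : ‖w - z‖ = r := by simpa [dist_eq_norm] using hw
      have := hexp w (sphere_subset_closedBall hw) z (mem_closedBall_self hr0.le)
      rwa [hw'] at this) (by
      have : ∀ᶠ w in 𝓝[≠] z, p w ≠ p z := by
        have hb : closedBall z r ∈ 𝓝[≠] z := mem_nhdsWithin_of_mem_nhds (closedBall_mem_nhds z hr0)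
        filter_upwards [hb, self_mem_nhdsWithin] with w hw hwz he
        have := hexp w hw z (mem_closedBall_self hr0.le)
        rw [he, sub_self, norm_zero] at this
        have h2 : 0 < ‖w - z‖ := norm_pos_iff.2 (sub_ne_zero.2 hwz)
        have : 0 < ‖α‖ / 2 * ‖w - z‖ := by positivity
        linarith
      exact this.frequently.filter_mono nhdsWithin_le_nhds)
  have hrad : ‖α‖ / 2 * r / 2 = κ / 4 * ‖α‖ ^ 2 := by rw [hr]; ring
  rw [hrad] at hsurj
  have hsurj' : ∀ w ∈ ball (p z) (κ / 4 * ‖α‖ ^ 2), ∃ x, x ∈ closedBall z r ∧ p x = w :=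
    fun w hw => hsurj hw
  choose! h hh using hsurj'
  have hsubb : ∀ w ∈ ball (p z) (κ / 4 * ‖α‖ ^ 2), h w ∈ closedBall z r ∧ p (h w) = w := hh
  refine ⟨h, ?_, fun w hw => ⟨hsubt (hsub (hsubb w hw).1), (hsubb w hw).2⟩⟩
  intro w hw
  have hnh := isOpen_ball.mem_nhds hw
  have hcont : ContinuousAt h w := by
    rw [Metric.continuousAt_iff']
    intro η hη
    filter_upwards [hnh, ball_mem_nhds w (show 0 < ‖α‖ / 2 * η by positivity)] with v hv hv'
    have := hexp _ (hsubb v hv).1 _ (hsubb w hw).1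
    rw [(hsubb v hv).2, (hsubb w hw).2] at this
    rw [mem_ball, dist_eq_norm] at hv'
    rw [dist_eq_norm]
    exact lt_of_mul_lt_mul_left (this.trans_lt hv') (by positivity)
  have hp : HasDerivAt p (deriv p (h w)) (h w) :=
    (hd.differentiableAt (isOpen_ball.mem_nhds (hsubt (hsub (hsubb w hw).1)))).hasDerivAt
  have hne : deriv p (h w) ≠ 0 := by
    intro h0
    have := hclose _ (hsubb w hw).1
    rw [h0, zero_sub, norm_neg] at this
    linarith
  have := HasDerivAt.of_local_left_inverse hcont hp hne
    (by filter_upwards [hnh] with v hv using (hsubb v hv).2)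
  exact this.differentiableAt.differentiableWithinAt

theorem norm_deriv_sq_le_of_multiple_zeros (M t : ℝ) (ht : 0 < t) :
    ∃ K > 0, ∀ (p : ℂ → ℂ) (z : ℂ), DifferentiableOn ℂ p (ball z t) →
      (∀ w ∈ ball z t, ‖p w‖ ≤ M) → (∀ w ∈ ball z t, p w = 0 → deriv p w = 0) →
      ‖deriv p z‖ ^ 2 ≤ K * ‖p z‖ := by
  obtain ⟨c, hc, H⟩ := exists_local_right_inverse M t ht
  refine ⟨1 / c, by positivity, fun p z hd hM hz => ?_⟩
  by_contra! hlt
  have hα : deriv p z ≠ 0 := by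
    intro h0
    rw [h0] at hlt
    have : 0 ≤ 1 / c * ‖p z‖ := by positivity
    norm_num at hlt
    norm_num at this
    linarith
  obtain ⟨h, hh, hp⟩ := H p z hd hM hα
  have h0 : (0 : ℂ) ∈ ball (p z) (c * ‖deriv p z‖ ^ 2) := by
    rw [mem_ball, dist_zero_left]
    have := mul_lt_mul_of_pos_left hlt hc
    rwa [← mul_assoc, mul_one_div_cancel hc.ne', one_mul] at this
  have hd0 := hz _ (hp 0 h0).1 (hp 0 h0).2
  have h1 : HasDerivAt p 0 (h 0) := by
    have := (hd.differentiableAt (isOpen_ball.mem_nhds (hp 0 h0).1)).hasDerivAt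
    rwa [hd0] at this
  have h2 := (hh.differentiableAt (isOpen_ball.mem_nhds h0)).hasDerivAt
  have h3 := h1.comp 0 h2
  have h4 : HasDerivAt (p ∘ h) 1 0 := by
    refine (hasDerivAt_id (0 : ℂ)).congr_of_eventuallyEq ?_
    filter_upwards [isOpen_ball.mem_nhds h0] with w hw using (hp w hw).2
  have := h3.unique h4
  simp at this

/-- An entire function dominated by another one is a constant multiple of it. -/
theorem exists_eq_const_mul_of_norm_le {f P : ℂ → ℂ} (hf : Differentiable ℂ f)
    (hP : Differentiable ℂ P) (hP0 : ∃ z, P z ≠ 0) {K : ℝ} (h : ∀ z, ‖f z‖ ≤ K * ‖P z‖) :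
    ∃ k : ℂ, ∀ z, f z = k * P z := by
  have hev : ∀ z, ∀ᶠ w in 𝓝[≠] z, P w ≠ 0 := by
    intro z
    rcases (hP.analyticAt z).eventually_eq_zero_or_eventually_ne_zero with h0 | h0
    · exfalso
      obtain ⟨w, hw⟩ := hP0
      have := AnalyticOnNhd.eq_of_eventuallyEq (f := P) (g := 0)
        (fun x _ => hP.analyticAt x) (fun x _ => analyticAt_const) h0
      exact hw (congrFun this w)
    · exact h0
  set q : ℂ → ℂ := fun z => f z / P z with hq
  set Q : ℂ → ℂ := fun z => limUnder (𝓝[≠] z) q with hQ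
  have hqd : ∀ z, P z ≠ 0 → DifferentiableAt ℂ q z := fun z hz => (hf z).div (hP z) hz
  have hqQ : ∀ z, P z ≠ 0 → Q z = q z := fun z hz =>
    ((hqd z hz).continuousAt.tendsto.mono_left nhdsWithin_le_nhds).limUnder_eq
  have hqb : ∀ z, P z ≠ 0 → ‖q z‖ ≤ K := by
    intro z hz
    rw [hq]; simp only [norm_div]
    rw [div_le_iff₀ (norm_pos_iff.2 hz)]
    exact h z
  have hQd : Differentiable ℂ Q := by
    intro z
    have hz := hev z
    rw [eventually_nhdsWithin_iff, Metric.eventually_nhds_iff_ball] at hz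
    obtain ⟨ε, hε, hz⟩ := hz
    have h1 := Complex.differentiableOn_update_limUnder_of_bddAbove (f := q)
      (ball_mem_nhds z hε)
      (fun w hw => (hqd w (hz w hw.1 hw.2)).differentiableWithinAt)
      ⟨K, by rintro _ ⟨w, hw, rfl⟩; exact hqb w (hz w hw.1 hw.2)⟩
    have h2 := h1.differentiableAt (ball_mem_nhds z hε)
    refine h2.congr_of_eventuallyEq ?_
    filter_upwards [ball_mem_nhds z hε] with w hw
    by_cases hwz : w = z
    · subst hwz; simp [hQ]
    · rw [Function.update_of_ne hwz, hqQ w (hz w hw hwz)]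
  have hQb : ∀ z, ‖Q z‖ ≤ K := by
    intro z
    have h1 : Tendsto Q (𝓝[≠] z) (𝓝 (Q z)) :=
      (hQd z).continuousAt.tendsto.mono_left nhdsWithin_le_nhds
    refine le_of_tendsto h1.norm ?_
    filter_upwards [hev z] with w hw
    rw [hqQ w hw]
    exact hqb w hw
  have hconst : ∀ z, Q z = Q 0 := fun z => hQd.apply_eq_apply_of_bounded
    ((isBounded_iff_forall_norm_le).2 ⟨K, by rintro _ ⟨w, rfl⟩; exact hQb w⟩) z 0
  refine ⟨Q 0, fun z => ?_⟩
  by_cases hz : P z = 0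
  · have := h z
    rw [hz, norm_zero, mul_zero] at this
    rw [hz, mul_zero]
    exact norm_le_zero_iff.1 this
  · rw [← hconst z, hqQ z hz, hq]
    field_simp

theorem exists_separation (S : Finset ℂ) :
    ∃ σ > 0, ∀ a ∈ S, ∀ b ∈ S, a ≠ b → 2 * σ ≤ dist a b := by
  have : ∀ᶠ σ in 𝓝[>] (0 : ℝ), ∀ p ∈ S.offDiag, 2 * σ ≤ dist p.1 p.2 := by
    rw [Filter.eventually_all_finset]
    intro p hp
    have hpos : 0 < dist p.1 p.2 / 2 := by
      have := dist_pos.2 (Finset.mem_offDiag.1 hp).2.2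
      positivity
    filter_upwards [Ioo_mem_nhdsGT hpos] with σ hσ
    linarith [hσ.2]
  obtain ⟨σ, h, hσ⟩ := (this.and self_mem_nhdsWithin).exists
  exact ⟨σ, hσ, fun a ha b hb hab => h (a, b) (Finset.mem_offDiag.2 ⟨ha, hb, hab⟩)⟩

theorem exists_norm_bound (S : Finset ℂ) : ∃ A : ℝ, 0 ≤ A ∧ ∀ a ∈ S, ‖a‖ ≤ A :=
  ⟨∑ a ∈ S, ‖a‖, Finset.sum_nonneg fun _ _ => norm_nonneg _, fun _ ha =>
    Finset.single_le_sum (f := fun a : ℂ => ‖a‖) (fun _ _ => norm_nonneg _) ha⟩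

theorem norm_deriv_sq_le_prod {g : ℂ → ℂ} (hg : Differentiable ℂ g) {C : ℝ}
    (hC : ∀ z, GrowthBound C g z) {S : Finset ℂ} (hS : S.card = 3)
    (hm : ∀ a ∈ S, ∀ z, g z = a → deriv g z = 0) :
    ∃ K : ℝ, ∀ z, ‖deriv g z‖ ^ 2 ≤ K * ∏ a ∈ S, ‖g z - a‖ := by
  obtain ⟨σ, hσ, hsep⟩ := exists_separation S
  obtain ⟨A, hA, hSA⟩ := exists_norm_bound S
  obtain ⟨t, ht, hloc⟩ := norm_le_of_growthBound (A + σ) (A + σ + 1) C (by positivity) (by linarith)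
  obtain ⟨KR, hKR, hR⟩ := norm_deriv_sq_le_of_multiple_zeros (A + σ + 1 + A) t ht
  set κ : ℝ := (1 + A) / σ + 1 with hκ
  have hκ0 : 0 < κ := by positivity
  set K1 : ℝ := |C| * κ ^ 6 + 1 with hK1
  have hK1p : 1 ≤ K1 := by have : 0 ≤ |C| * κ ^ 6 := by positivity
                           linarith
  refine ⟨K1 + KR / σ ^ 2, fun z => ?_⟩
  have hprod0 : 0 ≤ ∏ a ∈ S, ‖g z - a‖ := Finset.prod_nonneg fun _ _ => norm_nonneg _
  by_cases hcase : ∀ a ∈ S, σ ≤ ‖g z - a‖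
  · have h1 : ∀ a ∈ S, 1 + ‖g z‖ ≤ κ * ‖g z - a‖ := by
      intro a ha
      have e1 : ‖g z‖ ≤ ‖g z - a‖ + ‖a‖ := by simpa using norm_add_le (g z - a) a
      have e2 : 1 + A ≤ (1 + A) / σ * ‖g z - a‖ := by
        calc 1 + A = (1 + A) / σ * σ := by field_simp
          _ ≤ _ := by gcongr; exact hcase a ha
      rw [hκ]
      linarith [hSA a ha]
    have h2 : (1 + ‖g z‖) ^ 3 ≤ κ ^ 3 * ∏ a ∈ S, ‖g z - a‖ := by
      rw [← hS, ← Finset.prod_const, ← Finset.prod_const, ← Finset.prod_mul_distrib]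
      exact Finset.prod_le_prod (fun _ _ => by positivity) h1
    have h3 : (‖deriv g z‖ ^ 2) ^ 2 ≤ (K1 * ∏ a ∈ S, ‖g z - a‖) ^ 2 := by
      calc (‖deriv g z‖ ^ 2) ^ 2 = ‖deriv g z‖ ^ 4 := by ring
        _ ≤ C * (1 + ‖g z‖) ^ 5 := hC z
        _ ≤ |C| * (1 + ‖g z‖) ^ 6 := by
          gcongr
          · exact le_abs_self C
          · linarith [norm_nonneg (g z)]
          · norm_num
        _ = |C| * ((1 + ‖g z‖) ^ 3) ^ 2 := by ring
        _ ≤ |C| * (κ ^ 3 * ∏ a ∈ S, ‖g z - a‖) ^ 2 := by gcongr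
        _ = |C| * κ ^ 6 * (∏ a ∈ S, ‖g z - a‖) ^ 2 := by ring
        _ ≤ K1 ^ 2 * (∏ a ∈ S, ‖g z - a‖) ^ 2 := by
          gcongr
          nlinarith
        _ = _ := by ring
    have h4 := abs_le_of_sq_le_sq h3 (by positivity)
    refine (le_abs_self _).trans (h4.trans ?_)
    gcongr
    have : 0 ≤ KR / σ ^ 2 := by positivity
    linarith
  · push Not at hcase
    obtain ⟨a, ha, hlt⟩ := hcase
    have e1 : ‖g z‖ ≤ ‖g z - a‖ + ‖a‖ := by simpa using norm_add_le (g z - a) a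
    have hgz : ‖g z‖ ≤ A + σ := by linarith [hSA a ha]
    have hbd : ∀ w ∈ ball z t, ‖g w - a‖ ≤ A + σ + 1 + A := by
      intro w hw
      have := hloc g univ convex_univ isOpen_univ hg.differentiableOn (fun w _ => hC w) z trivial w
        trivial hgz (mem_ball.1 hw).le
      linarith [norm_sub_le (g w) a, hSA a ha]
    have h1 := hR (fun w => g w - a) z ((hg.sub_const a).differentiableOn) hbd (fun w _ hw => by
      rw [deriv_sub_const]
      exact hm a ha w (sub_eq_zero.1 hw))
    rw [deriv_sub_const] at h1
    have h2 : σ ^ 2 ≤ ∏ b ∈ S.erase a, ‖g z - b‖ := by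
      have hc : (S.erase a).card = 2 := by rw [Finset.card_erase_of_mem ha, hS]
      rw [← hc, ← Finset.prod_const]
      refine Finset.prod_le_prod (fun _ _ => hσ.le) fun b hb => ?_
      have := hsep a ha b (Finset.mem_of_mem_erase hb) (Finset.ne_of_mem_erase hb).symm
      rw [dist_eq_norm] at this
      have e : ‖a - b‖ ≤ ‖g z - b‖ + ‖g z - a‖ := by
        have : a - b = (g z - b) - (g z - a) := by ring
        rw [this]; exact norm_sub_le _ _
      linarith
    refine h1.trans ?_
    rw [← Finset.mul_prod_erase S (fun b => ‖g z - b‖) ha]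
    calc KR * ‖g z - a‖ = KR / σ ^ 2 * (‖g z - a‖ * σ ^ 2) := by field_simp
      _ ≤ KR / σ ^ 2 * (‖g z - a‖ * ∏ b ∈ S.erase a, ‖g z - b‖) := by gcongr
      _ ≤ (K1 + KR / σ ^ 2) * (‖g z - a‖ * ∏ b ∈ S.erase a, ‖g z - b‖) := by
        gcongr
        linarith

/-- An entire function of restricted growth that is totally ramified over three values has
vanishing derivative. -/
theorem deriv_eq_zero_of_ramified {g : ℂ → ℂ} (hg : Differentiable ℂ g) {C : ℝ}
    (hC : ∀ z, GrowthBound C g z) {S : Finset ℂ} (hS : S.card = 3)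
    (hm : ∀ a ∈ S, ∀ z, g z = a → deriv g z = 0) (z : ℂ) : deriv g z = 0 := by
  obtain ⟨K, hK⟩ := norm_deriv_sq_le_prod hg hC hS hm
  obtain ⟨A, hA, hSA⟩ := exists_norm_bound S
  set P : ℂ → ℂ := fun z => ∏ a ∈ S, (g z - a) with hP
  have hPn : ∀ z, ‖P z‖ = ∏ a ∈ S, ‖g z - a‖ := fun z => by rw [hP]; simp [norm_prod]
  have hPd : Differentiable ℂ P := by
    rw [hP]; fun_prop
  have hbounded : (∃ B : ℝ, ∀ z, ‖g z‖ ≤ B) → deriv g z = 0 := by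
    rintro ⟨B, hB⟩
    have : g = fun _ => g 0 := funext fun z => hg.apply_eq_apply_of_bounded
      ((isBounded_iff_forall_norm_le).2 ⟨B, by rintro _ ⟨w, rfl⟩; exact hB w⟩) z 0
    rw [this]; simp
  by_cases hP0 : ∃ z, P z ≠ 0
  · obtain ⟨k, hk⟩ := exists_eq_const_mul_of_norm_le (f := fun z => deriv g z ^ 2)
      (hg.deriv.pow 2) hPd hP0 (K := K) (fun z => by rw [norm_pow, hPn]; exact hK z)
    by_cases hk0 : k = 0
    · have := hk z
      rw [hk0, zero_mul] at this
      exact pow_eq_zero_iff (two_ne_zero) |>.1 this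
    · apply hbounded
      have hkn : 0 < ‖k‖ := norm_pos_iff.2 hk0
      refine ⟨max (2 * A + 1) (C * 4 ^ 6 / ‖k‖ ^ 2), fun z => ?_⟩
      by_contra! hlt
      have h1 := (le_max_left _ _).trans_lt hlt
      have h2 := (le_max_right _ _).trans_lt hlt
      have h3 : ((1 + ‖g z‖) / 4) ^ 3 ≤ ‖P z‖ := by
        have hc : ((1 + ‖g z‖) / 4) ^ 3 = ∏ _a ∈ S, (1 + ‖g z‖) / 4 := by
          rw [Finset.prod_const, hS]
        rw [hPn, hc]
        refine Finset.prod_le_prod (fun _ _ => by positivity) fun a ha => ?_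
        have := norm_sub_norm_le (g z) a
        linarith [hSA a ha]
      have h4 : ‖k‖ ^ 2 * ‖P z‖ ^ 2 ≤ C * (1 + ‖g z‖) ^ 5 := by
        calc _ = ‖k * P z‖ ^ 2 := by rw [norm_mul]; ring
          _ = ‖deriv g z‖ ^ 4 := by rw [← hk z, norm_pow]; ring
          _ ≤ _ := hC z
      have h5 : ‖k‖ ^ 2 * (((1 + ‖g z‖) / 4) ^ 3) ^ 2 ≤ C * (1 + ‖g z‖) ^ 5 := by
        refine le_trans ?_ h4
        gcongr
      have h6 : ‖k‖ ^ 2 * (1 + ‖g z‖) * (1 + ‖g z‖) ^ 5 ≤ C * 4 ^ 6 * (1 + ‖g z‖) ^ 5 := by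
        calc _ = (‖k‖ ^ 2 * (((1 + ‖g z‖) / 4) ^ 3) ^ 2) * 4 ^ 6 := by ring
          _ ≤ (C * (1 + ‖g z‖) ^ 5) * 4 ^ 6 := by gcongr
          _ = _ := by ring
      have h7 := le_of_mul_le_mul_right h6 (by positivity)
      rw [div_lt_iff₀ (by positivity)] at h2
      nlinarith
  · push Not at hP0
    have h1 := hP0 z
    rw [hP] at h1
    obtain ⟨a, ha, h2⟩ := Finset.prod_eq_zero_iff.1 h1
    exact hm a ha z (sub_eq_zero.1 h2)

/-- Zalcman-type rescaling. -/
theorem exists_rescaling {Φ : ℂ → ℂ} (hd : DifferentiableOn ℂ Φ (ball 0 1)) {M : ℝ} (hM : 0 < M)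
    (h : M ^ 4 * (1 + ‖Φ 0‖) ^ 5 ≤ ‖deriv Φ 0‖ ^ 4) :
    ∃ (z₀ : ℂ) (ρ : ℝ), (∀ ζ ∈ ball (0 : ℂ) (M / 4), z₀ + ρ * ζ ∈ ball (0 : ℂ) 1) ∧
      DifferentiableOn ℂ (fun ζ => Φ (z₀ + ρ * ζ)) (ball 0 (M / 4)) ∧
      (∀ ζ ∈ ball (0 : ℂ) (M / 4), GrowthBound 16 (fun ζ => Φ (z₀ + ρ * ζ)) ζ) ∧
      (1 + ‖Φ (z₀ + ρ * 0)‖) ^ 5 = ‖deriv (fun ζ => Φ (z₀ + ρ * ζ)) 0‖ ^ 4 := by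
  have hsub : closedBall (0 : ℂ) (1 / 2) ⊆ ball 0 1 := closedBall_subset_ball (by norm_num)
  have hdd : DifferentiableOn ℂ (deriv Φ) (ball 0 1) := hd.deriv isOpen_ball
  have hpos : ∀ z, 0 < (1 + ‖Φ z‖) ^ 5 := fun z => by positivity
  set D : ℂ → ℝ := fun z => ‖deriv Φ z‖ ^ 4 / (1 + ‖Φ z‖) ^ 5 with hD
  have hcont : ContinuousOn (fun z : ℂ => (1 / 2 - ‖z‖) ^ 4 * D z) (closedBall 0 (1 / 2)) := by
    refine ContinuousOn.mul (by fun_prop) (ContinuousOn.div ?_ ?_ fun z _ => (hpos z).ne')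
    · exact ((hdd.continuousOn.mono hsub).norm).pow 4
    · exact (continuousOn_const.add (hd.continuousOn.mono hsub).norm).pow 5
  obtain ⟨z₀, hz₀, hmax⟩ := (isCompact_closedBall (0 : ℂ) (1 / 2)).exists_isMaxOn
    ⟨0, mem_closedBall_self (by norm_num)⟩ hcont
  have hmax : ∀ z ∈ closedBall (0 : ℂ) (1 / 2),
      (1 / 2 - ‖z‖) ^ 4 * D z ≤ (1 / 2 - ‖z₀‖) ^ 4 * D z₀ := fun z hz => hmax hz
  have hD0 : ∀ z, 0 ≤ D z := fun z => by positivity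
  have hDM : M ^ 4 ≤ D 0 := by rw [hD]; simp only; rwa [le_div_iff₀ (hpos 0)]
  set d := 1 / 2 - ‖z₀‖ with hdef
  have hz₀' : ‖z₀‖ ≤ 1 / 2 := by simpa using hz₀
  have hd0 : 0 ≤ d := by linarith
  have hu0 : (M / 2) ^ 4 ≤ d ^ 4 * D z₀ := by
    have := hmax 0 (mem_closedBall_self (by norm_num))
    simp only [norm_zero, sub_zero] at this
    refine le_trans ?_ this
    calc (M / 2) ^ 4 = (1 / 2) ^ 4 * M ^ 4 := by ring
      _ ≤ _ := by gcongr
  have hM4 : 0 < (M / 2) ^ 4 := by positivity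
  have hdpos : 0 < d := by
    rcases hd0.eq_or_lt with h0 | h0
    · rw [← h0] at hu0; norm_num at hu0; linarith [pow_pos hM 4]
    · exact h0
  have hDpos : 0 < D z₀ := by
    rcases (hD0 z₀).eq_or_lt with h0 | h0
    · rw [← h0] at hu0; norm_num at hu0; linarith [pow_pos hM 4]
    · exact h0
  set ρ : ℝ := (1 / D z₀) ^ (1 / 4 : ℝ) with hρ
  have hρ0 : 0 < ρ := by positivity
  have hρ4 : ρ ^ 4 * D z₀ = 1 := by
    rw [hρ, ← Real.rpow_natCast, ← Real.rpow_mul (by positivity)]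
    norm_num
    exact inv_mul_cancel₀ hDpos.ne'
  have hdρ : M / 2 * ρ ≤ d := by
    refine le_of_pow_le_pow_left₀ (n := 4) (by norm_num) hd0 ?_
    calc (M / 2 * ρ) ^ 4 = (M / 2) ^ 4 * ρ ^ 4 := by ring
      _ ≤ d ^ 4 * D z₀ * ρ ^ 4 := by gcongr
      _ = d ^ 4 * (ρ ^ 4 * D z₀) := by ring
      _ = d ^ 4 := by rw [hρ4, mul_one]
  have hloc : ∀ ζ ∈ ball (0 : ℂ) (M / 4), ‖z₀ + ρ * ζ‖ ≤ 1 / 2 - d / 2 := by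
    intro ζ hζ
    have hζ' : ‖ζ‖ < M / 4 := by simpa using hζ
    have h1 := norm_add_le z₀ (ρ * ζ)
    rw [norm_mul, Complex.norm_real, Real.norm_of_nonneg hρ0.le] at h1
    have h2 : ρ * ‖ζ‖ ≤ ρ * (M / 4) := by gcongr
    linarith
  have hmem : ∀ ζ ∈ ball (0 : ℂ) (M / 4), z₀ + ρ * ζ ∈ ball (0 : ℂ) 1 := by
    intro ζ hζ
    have := hloc ζ hζ
    rw [mem_ball_zero_iff]; linarith
  have hder : ∀ ζ ∈ ball (0 : ℂ) (M / 4), HasDerivAt (fun ζ => Φ (z₀ + ρ * ζ))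
      (deriv Φ (z₀ + ρ * ζ) * ρ) ζ := by
    intro ζ hζ
    have h1 := (hd.differentiableAt (isOpen_ball.mem_nhds (hmem ζ hζ))).hasDerivAt
    have h2 : HasDerivAt (fun ζ : ℂ => z₀ + ρ * ζ) ρ ζ := by
      simpa using ((hasDerivAt_id ζ).const_mul (ρ : ℂ)).const_add z₀
    simpa [Function.comp_def] using h1.comp_of_eq ζ h2 rfl
  have hnd : ∀ ζ ∈ ball (0 : ℂ) (M / 4), ‖deriv (fun ζ => Φ (z₀ + ρ * ζ)) ζ‖ ^ 4
      = ρ ^ 4 * D (z₀ + ρ * ζ) * (1 + ‖Φ (z₀ + ρ * ζ)‖) ^ 5 := by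
    intro ζ hζ
    rw [(hder ζ hζ).deriv, norm_mul, Complex.norm_real, Real.norm_of_nonneg hρ0.le, hD]
    simp only
    rw [mul_assoc, div_mul_cancel₀ _ (hpos _).ne']
    ring
  refine ⟨z₀, ρ, hmem, fun ζ hζ => (hder ζ hζ).differentiableAt.differentiableWithinAt, ?_, ?_⟩
  · intro ζ hζ
    unfold GrowthBound
    rw [hnd ζ hζ]
    refine mul_le_mul_of_nonneg_right ?_ (hpos _).le
    have h1 := hloc ζ hζ
    have h2 := hmax (z₀ + ρ * ζ) (by rw [mem_closedBall_zero_iff]; linarith)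
    have h3 : (d / 2) ^ 4 * D (z₀ + ρ * ζ) ≤ d ^ 4 * D z₀ := by
      refine le_trans ?_ h2
      have := hD0 (z₀ + ρ * ζ)
      gcongr
      linarith
    have h4 : d ^ 4 * D (z₀ + ρ * ζ) ≤ d ^ 4 * (16 * D z₀) := by
      linarith
    have h5 := le_of_mul_le_mul_left h4 (by positivity)
    calc ρ ^ 4 * D (z₀ + ρ * ζ) ≤ ρ ^ 4 * (16 * D z₀) := by gcongr
      _ = 16 * (ρ ^ 4 * D z₀) := by ring
      _ = 16 := by rw [hρ4, mul_one]
  · have h0 := hnd 0 (mem_ball_self (by positivity))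
    rw [h0, mul_zero, add_zero, hρ4, one_mul]

theorem exists_island_unit {S : Finset ℂ} (hS : S.card = 3) :
    ∃ δ > 0, ∃ C > 0, ∀ Φ : ℂ → ℂ, DifferentiableOn ℂ Φ (ball 0 1) →
      C * (1 + ‖Φ 0‖) ^ 5 ≤ ‖deriv Φ 0‖ ^ 4 →
      ∃ a ∈ S, ∃ h : ℂ → ℂ, DifferentiableOn ℂ h (ball a δ) ∧
        ∀ w ∈ ball a δ, h w ∈ ball (0 : ℂ) 1 ∧ Φ (h w) = w := by
  by_contra hcon
  have hseq : ∀ m : ℕ, ∃ Φ : ℂ → ℂ, DifferentiableOn ℂ Φ (ball 0 1) ∧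
      ((m : ℝ) + 4) ^ 4 * (1 + ‖Φ 0‖) ^ 5 ≤ ‖deriv Φ 0‖ ^ 4 ∧
      ¬ ∃ a ∈ S, ∃ h : ℂ → ℂ, DifferentiableOn ℂ h (ball a (1 / ((m : ℝ) + 1))) ∧
        ∀ w ∈ ball a (1 / ((m : ℝ) + 1)), h w ∈ ball (0 : ℂ) 1 ∧ Φ (h w) = w := by
    intro m
    by_contra hm
    apply hcon
    refine ⟨1 / ((m : ℝ) + 1), by positivity, ((m : ℝ) + 4) ^ 4, by positivity, fun Φ h1 h2 => ?_⟩
    by_contra h3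
    exact hm ⟨Φ, h1, h2, h3⟩
  choose Φ hΦd hΦb hΦn using hseq
  choose z₀ ρ hmem hgd hgb hg0 using fun m : ℕ =>
    exists_rescaling (hΦd m) (show (0 : ℝ) < (m : ℝ) + 4 by positivity) (hΦb m)
  set g : ℕ → ℂ → ℂ := fun m ζ => Φ m (z₀ m + ρ m * ζ) with hgdef
  obtain ⟨K, hK⟩ := norm_le_of_growthBound_of_eq
  set U : Ultrafilter ℕ := hyperfilter ℕ
  have hU : (U : Filter ℕ) ≤ atTop := Nat.hyperfilter_le_atTop
  have hlarge : ∀ x : ℝ, ∀ᶠ m : ℕ in (U : Filter ℕ), x ≤ m := fun x =>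
    hU ((tendsto_natCast_atTop_atTop (R := ℝ)).eventually_ge_atTop x)
  have hballs : ∀ (ζ : ℂ) (t : ℝ), ∀ᶠ m : ℕ in (U : Filter ℕ),
      ball ζ t ⊆ ball (0 : ℂ) (((m : ℝ) + 4) / 4) := by
    intro ζ t
    filter_upwards [hlarge (4 * (‖ζ‖ + t))] with m hm
    intro w hw
    rw [mem_ball_zero_iff]
    rw [mem_ball, dist_eq_norm] at hw
    have := norm_le_norm_add_norm_sub' w ζ
    linarith
  have hTame : ∀ ζ ∈ (univ : Set ℂ), Tame (U : Filter ℕ) g ζ := by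
    intro ζ _
    refine ⟨1, one_pos, 16, ?_⟩
    filter_upwards [hballs ζ 1] with m hm
    exact ⟨(hgd m).mono hm, fun w hw => hgb m w (hm hw)⟩
  have hbd0 : ∀ᶠ m in (U : Filter ℕ), ‖g m 0‖ ≤ K := by
    filter_upwards [hballs 0 1] with m hm
    exact hK (g m) ((hgd m).mono hm) (fun w hw => hgb m w (hm hw)) (hg0 m).le
  have hLB := LocBdd.of_preconnected isPreconnected_univ hTame (mem_univ 0) hbd0
  obtain ⟨G, hG⟩ := LocBdd.exists_limit (U := U) (Φ := g)
  have hG : ∀ ζ, LocUnif U g G ζ := fun ζ => hG ζ (hLB ζ trivial)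
  have hGd : Differentiable ℂ G := fun ζ => (hG ζ).differentiableAt
  have hGb : ∀ ζ, GrowthBound 16 G ζ := by
    intro ζ
    have h1 := (hG ζ).tendsto
    have h2 := (hG ζ).deriv.tendsto
    refine le_of_tendsto_of_tendsto (h2.norm.pow 4)
      (((h1.norm.const_add 1).pow 5).const_mul 16) ?_
    filter_upwards [hballs ζ 1] with m hm
    exact hgb m ζ (hm (mem_ball_self one_pos))
  have hG0 : deriv G 0 ≠ 0 := by
    have h1 := (hG 0).tendsto
    have h2 := (hG 0).deriv.tendsto
    have h3 := tendsto_nhds_unique ((h1.norm.const_add 1).pow 5)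
      ((h2.norm.pow 4).congr fun m => (hg0 m).symm)
    intro h0
    rw [h0] at h3
    have : 0 < (1 + ‖G 0‖) ^ 5 := by positivity
    rw [norm_zero, zero_pow (by norm_num)] at h3
    linarith
  obtain ⟨a, ha, ζ, hζa, hζd⟩ : ∃ a ∈ S, ∃ ζ, G ζ = a ∧ deriv G ζ ≠ 0 := by
    by_contra! hno
    exact hG0 (deriv_eq_zero_of_ramified hGd hGb hS hno 0)
  obtain ⟨ε, hε, B, hB⟩ := hLB ζ trivial
  obtain ⟨c, hc, hinv⟩ := exists_local_right_inverse B ε hε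
  set β := ‖deriv G ζ‖ / 2 with hβ
  have hβ0 : 0 < β := by have := norm_pos_iff.2 hζd; positivity
  set r := c * β ^ 2 with hr
  have hr0 : 0 < r := by positivity
  have h1 : ∀ᶠ m in (U : Filter ℕ), dist (g m ζ) a < r / 2 := by
    have := (hG ζ).tendsto
    rw [hζa] at this
    exact (Metric.tendsto_nhds.1 this) _ (by positivity)
  have h2 : ∀ᶠ m in (U : Filter ℕ), β < ‖deriv (g m) ζ‖ := by
    have := (hG ζ).deriv.tendsto.norm
    exact this.eventually_const_lt (by rw [hβ]; linarith)
  obtain ⟨m, hm1, hm2, hm3, hm4, hm5⟩ :=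
    (h1.and (h2.and (hB.and ((hballs ζ ε).and (hlarge (2 / r)))))).exists
  obtain ⟨h, hh, hgh⟩ := hinv (g m) ζ hm3.1 hm3.2 (norm_pos_iff.1 (hβ0.trans hm2))
  have hsub : ball a (1 / ((m : ℝ) + 1)) ⊆ ball (g m ζ) (c * ‖deriv (g m) ζ‖ ^ 2) := by
    intro w hw
    rw [mem_ball] at *
    have e1 : 1 / ((m : ℝ) + 1) ≤ r / 2 := by
      rw [div_le_iff₀ hr0] at hm5
      rw [div_le_iff₀ (by positivity)]
      nlinarith
    have e2 : r ≤ c * ‖deriv (g m) ζ‖ ^ 2 := by rw [hr]; gcongr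
    linarith [dist_triangle_right w (g m ζ) a]
  refine hΦn m ⟨a, ha, fun w => z₀ m + ρ m * h w, ?_, ?_⟩
  · exact ((hh.mono hsub).const_mul _).const_add _
  · intro w hw
    obtain ⟨e1, e2⟩ := hgh w (hsub hw)
    exact ⟨hmem m _ (hm4 e1), e2⟩

/-- Three-islands theorem. -/
theorem exists_island {S : Finset ℂ} (hS : S.card = 3) :
    ∃ δ > 0, ∃ C > 0, ∀ (Φ : ℂ → ℂ) (b : ℂ) (ε : ℝ), 0 < ε → DifferentiableOn ℂ Φ (ball b ε) →
      C * (1 + ‖Φ b‖) ^ 5 ≤ ε ^ 4 * ‖deriv Φ b‖ ^ 4 →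
      ∃ a ∈ S, ∃ h : ℂ → ℂ, DifferentiableOn ℂ h (ball a δ) ∧
        ∀ w ∈ ball a δ, h w ∈ ball b ε ∧ Φ (h w) = w := by
  obtain ⟨δ, hδ, C, hC, H⟩ := exists_island_unit hS
  refine ⟨δ, hδ, C, hC, fun Φ b ε hε hd hb => ?_⟩
  have hmem : ∀ ζ ∈ ball (0 : ℂ) 1, b + ε * ζ ∈ ball b ε := by
    intro ζ hζ
    rw [mem_ball_zero_iff] at hζ
    rw [mem_ball, dist_eq_norm, add_sub_cancel_left, norm_mul, Complex.norm_real,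
      Real.norm_of_nonneg hε.le]
    nlinarith
  have hder : ∀ ζ ∈ ball (0 : ℂ) 1, HasDerivAt (fun ζ => Φ (b + ε * ζ))
      (deriv Φ (b + ε * ζ) * ε) ζ := by
    intro ζ hζ
    have h1 := (hd.differentiableAt (isOpen_ball.mem_nhds (hmem ζ hζ))).hasDerivAt
    have h2 : HasDerivAt (fun ζ : ℂ => b + ε * ζ) ε ζ := by
      simpa using ((hasDerivAt_id ζ).const_mul (ε : ℂ)).const_add b
    simpa [Function.comp_def] using h1.comp_of_eq ζ h2 rfl
  obtain ⟨a, ha, h, hh, hΦ⟩ := H (fun ζ => Φ (b + ε * ζ))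
    (fun ζ hζ => (hder ζ hζ).differentiableAt.differentiableWithinAt) (by
      rw [(hder 0 (mem_ball_self one_pos)).deriv, norm_mul, Complex.norm_real,
        Real.norm_of_nonneg hε.le, mul_zero, add_zero, mul_pow]
      linarith)
  exact ⟨a, ha, fun w => b + ε * h w, (hh.const_mul _).const_add _, fun w hw =>
    ⟨hmem _ (hΦ w hw).1, (hΦ w hw).2⟩⟩

/-- For functions without zeros, a single nonzero value always has an island. -/
theorem exists_island_of_ne_zero {a : ℂ} (ha : a ≠ 0) :
    ∃ δ > 0, ∃ C > 0, ∀ (Φ : ℂ → ℂ) (b : ℂ) (ε : ℝ), 0 < ε → DifferentiableOn ℂ Φ (ball b ε) →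
      (∀ z ∈ ball b ε, Φ z ≠ 0) → C * (1 + ‖Φ b‖) ^ 5 ≤ ε ^ 4 * ‖deriv Φ b‖ ^ 4 →
      ∃ h : ℂ → ℂ, DifferentiableOn ℂ h (ball a δ) ∧
        ∀ w ∈ ball a δ, h w ∈ ball b ε ∧ Φ (h w) = w := by
  have ha0 : 0 < ‖a‖ := norm_pos_iff.2 ha
  obtain ⟨s, hs, hs2⟩ := exists_root_on_ball (g := fun z : ℂ => z) (c := a) (r := ‖a‖)
    differentiableOn_id (fun z hz h0 => by
      rw [h0, mem_ball, dist_zero_left] at hz; exact lt_irrefl _ hz) (two_ne_zero)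
  have haa := mem_ball_self (x := a) ha0
  have hsa := hs2 a haa
  have hsa0 : s a ≠ 0 := by
    intro h; rw [h] at hsa; apply ha; rw [← hsa]; norm_num
  have hne : s a ≠ -s a := fun h => hsa0 (self_eq_neg.1 h)
  have hS : ({s a, -s a, 0} : Finset ℂ).card = 3 :=
    Finset.card_eq_three.2 ⟨_, _, _, hne, hsa0, neg_ne_zero.2 hsa0, rfl⟩
  obtain ⟨δ₀, hδ₀, C, hC, H⟩ := exists_island hS
  have hcont : ContinuousAt s a := (hs.differentiableAt (isOpen_ball.mem_nhds haa)).continuousAt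
  obtain ⟨δ₁, hδ₁, hδs⟩ := Metric.continuousAt_iff.1 hcont δ₀ hδ₀
  refine ⟨min δ₁ ‖a‖, lt_min hδ₁ ha0, 512 * C, by positivity, ?_⟩
  intro Φ b ε hε hd h0 hb
  have hsub : ball a (min δ₁ ‖a‖) ⊆ ball a ‖a‖ := ball_subset_ball (min_le_right _ _)
  have hsub' : ball a (min δ₁ ‖a‖) ⊆ ball a δ₁ := ball_subset_ball (min_le_left _ _)
  obtain ⟨ψ, hψ, hψ2⟩ := exists_root_on_ball hd h0 (two_ne_zero)
  have hbb := mem_ball_self (x := b) hε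
  have hder : 2 * ψ b * deriv ψ b = deriv Φ b := by
    have h1 := (hψ.differentiableAt (isOpen_ball.mem_nhds hbb)).hasDerivAt.fun_pow 2
    have h2 : HasDerivAt (fun z => ψ z ^ 2) (deriv Φ b) b := by
      refine (hd.differentiableAt (isOpen_ball.mem_nhds hbb)).hasDerivAt.congr_of_eventuallyEq ?_
      filter_upwards [isOpen_ball.mem_nhds hbb] with w hw using hψ2 w hw
    simpa using h1.unique h2
  have hψb : 0 < ‖ψ b‖ := by
    rw [norm_pos_iff]; intro h
    apply h0 b hbb
    rw [← hψ2 b hbb, h]; norm_num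
  have key : C * (1 + ‖ψ b‖) ^ 5 ≤ ε ^ 4 * ‖deriv ψ b‖ ^ 4 := by
    rw [← hder, ← hψ2 b hbb, norm_mul, norm_mul, norm_pow] at hb
    norm_num at hb
    set x := ‖ψ b‖
    set y := ‖deriv ψ b‖
    have e1 : (1 + x) ^ 2 ≤ 2 * (1 + x ^ 2) := by nlinarith [sq_nonneg (1 - x)]
    have e2 : (1 + x) ^ 10 ≤ 32 * (1 + x ^ 2) ^ 5 := by
      calc (1 + x) ^ 10 = ((1 + x) ^ 2) ^ 5 := by ring
        _ ≤ (2 * (1 + x ^ 2)) ^ 5 := by gcongr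
        _ = _ := by ring
    have e3 : (1 + x) ^ 5 * x ^ 4 ≤ (1 + x) ^ 10 := by
      calc (1 + x) ^ 5 * x ^ 4 ≤ (1 + x) ^ 5 * (1 + x) ^ 5 := by
            gcongr
            calc x ^ 4 ≤ (1 + x) ^ 4 := by gcongr; linarith
              _ ≤ (1 + x) ^ 5 := pow_le_pow_right₀ (by linarith) (by norm_num)
        _ = _ := by ring
    have e4 : C * (1 + x) ^ 5 * x ^ 4 ≤ ε ^ 4 * y ^ 4 * x ^ 4 := by
      have : C * ((1 + x) ^ 5 * x ^ 4) ≤ C * (32 * (1 + x ^ 2) ^ 5) :=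
        mul_le_mul_of_nonneg_left (e3.trans e2) hC.le
      have e5 : ε ^ 4 * (2 * x * y) ^ 4 = 16 * (ε ^ 4 * y ^ 4 * x ^ 4) := by ring
      linarith
    exact le_of_mul_le_mul_right e4 (by positivity)
  obtain ⟨c, hcS, h, hh, hψh⟩ := H ψ b ε hε hψ key
  have hfin : ∀ σ : ℂ, σ ^ 2 = 1 → c = σ * s a → ‖σ‖ = 1 → ∃ h : ℂ → ℂ,
      DifferentiableOn ℂ h (ball a (min δ₁ ‖a‖)) ∧
        ∀ w ∈ ball a (min δ₁ ‖a‖), h w ∈ ball b ε ∧ Φ (h w) = w := by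
    intro σ hσ hc hσn
    have hm : MapsTo (fun w => σ * s w) (ball a (min δ₁ ‖a‖)) (ball c δ₀) := by
      intro w hw
      rw [mem_ball, hc, dist_eq_norm, ← mul_sub, norm_mul, hσn, one_mul, ← dist_eq_norm]
      exact hδs (hsub' hw)
    refine ⟨fun w => h (σ * s w), hh.comp ((hs.mono hsub).const_mul σ) hm, fun w hw => ?_⟩
    obtain ⟨h1, h2⟩ := hψh _ (hm hw)
    refine ⟨h1, ?_⟩
    simp only
    rw [← hψ2 _ h1, h2, mul_pow, hσ, one_mul, hs2 w (hsub hw)]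
  simp only [Finset.mem_insert, Finset.mem_singleton] at hcS
  rcases hcS with hc | hc | hc
  · exact hfin 1 (by norm_num) (by simpa using hc) (by simp)
  · exact hfin (-1) (by norm_num) (by simpa using hc) (by simp)
  · exfalso
    subst hc
    obtain ⟨h1, h2⟩ := hψh 0 (mem_ball_self hδ₀)
    apply h0 _ h1
    rw [← hψ2 _ h1, h2]; norm_num

theorem exists_iteratedDeriv_ne_zero {f : ℂ → ℂ} (hf : Differentiable ℂ f)
    (htrans : ¬ ∃ p : Polynomial ℂ, ∀ z : ℂ, f z = p.eval z) (m : ℕ) :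
    ∃ j > m, iteratedDeriv j f 0 ≠ 0 := by
  by_contra! h
  apply htrans
  refine ⟨∑ j ∈ Finset.range (m + 1),
    Polynomial.C ((j.factorial : ℂ)⁻¹ * iteratedDeriv j f 0) * Polynomial.X ^ j, fun z => ?_⟩
  rw [← taylorSeries_eq_of_entire' 0 z hf, tsum_eq_sum (s := Finset.range (m + 1))]
  · simp [Polynomial.eval_finsetSum]
  · intro j hj
    rw [h j (by simpa using hj)]
    simp

theorem norm_iteratedDeriv_le_of_entire {f : ℂ → ℂ} (hf : Differentiable ℂ f) {R M : ℝ}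
    (hR : 0 < R) (hM : ∀ z, ‖z‖ = R → ‖f z‖ ≤ M) (j : ℕ) :
    ‖iteratedDeriv j f 0‖ ≤ j.factorial * M / R ^ j :=
  norm_iteratedDeriv_le_of_forall_mem_sphere_norm_le j hR hf.diffContOnCl
    fun z hz => hM z (by simpa using hz)

theorem exists_frequently_bounded {f : ℂ → ℂ} (hf : Differentiable ℂ f)
    (htrans : ¬ ∃ p : Polynomial ℂ, ∀ z : ℂ, f z = p.eval z) :
    ∃ K : ℝ, ∃ᶠ R : ℝ in atTop, ∃ z, ‖z‖ = R ∧ ‖f z‖ ≤ K := by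
  by_contra! hcon
  set g : ℂ → ℂ := Function.update (fun w => (f w⁻¹)⁻¹) 0 0 with hg
  have hlarge : ∀ K : ℝ, ∀ᶠ w in 𝓝[≠] (0 : ℂ), K < ‖f w⁻¹‖ := by
    intro K
    have h1 : Tendsto (fun w : ℂ => ‖w⁻¹‖) (𝓝[≠] 0) atTop := by
      exact tendsto_norm_cobounded_atTop.comp (tendsto_inv₀_nhdsNE_zero (α := ℂ))
    filter_upwards [h1.eventually (hcon K)] with w hw using hw _ rfl
  have hgw : ∀ w, w ≠ 0 → g w = (f w⁻¹)⁻¹ := fun w hw => Function.update_of_ne hw _ _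
  have hgc : ContinuousAt g 0 := by
    rw [hg, continuousAt_update_same]
    have h1 : Tendsto (fun w => ‖f w⁻¹‖) (𝓝[≠] (0 : ℂ)) atTop :=
      Filter.tendsto_atTop.2 fun K => (hlarge K).mono fun w hw => hw.le
    have h2 := tendsto_inv_atTop_zero.comp h1
    rw [tendsto_zero_iff_norm_tendsto_zero]
    simpa [Function.comp_def] using h2
  have hgd : ∀ᶠ w in 𝓝[≠] (0 : ℂ), DifferentiableAt ℂ g w := by
    filter_upwards [hlarge 0, self_mem_nhdsWithin] with w hw hw0
    have h1 : DifferentiableAt ℂ (fun w : ℂ => (f w⁻¹)⁻¹) w :=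
      ((hf _).comp w (differentiableAt_inv hw0)).inv (norm_pos_iff.1 hw)
    refine h1.congr_of_eventuallyEq ?_
    filter_upwards [isOpen_ne.mem_nhds hw0] with v hv using hgw v hv
  have hga := analyticAt_of_differentiable_on_punctured_nhds_of_continuousAt hgd hgc
  have hnz : ¬ ∀ᶠ w in 𝓝 (0 : ℂ), g w = 0 := by
    intro h
    obtain ⟨w, h1, h2, h3⟩ := ((h.filter_mono nhdsWithin_le_nhds).and
      ((hlarge 0).and (self_mem_nhdsWithin (s := {(0 : ℂ)}ᶜ)))).exists
    rw [hgw w h3] at h1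
    exact norm_pos_iff.1 h2 (inv_eq_zero.1 h1)
  obtain ⟨m, k, hka, hk0, hgk⟩ := hga.exists_eventuallyEq_pow_smul_nonzero_iff.2 hnz
  set c := ‖k 0‖ / 2
  have hc : 0 < c := by have := norm_pos_iff.2 hk0; positivity
  have hkc : ∀ᶠ w in 𝓝 (0 : ℂ), c < ‖k w‖ :=
    hka.continuousAt.norm.eventually_const_lt (by
      have := norm_pos_iff.2 hk0
      change ‖k 0‖ / 2 < ‖k 0‖; linarith)
  have hall : ∀ᶠ w in 𝓝[≠] (0 : ℂ), ‖f w⁻¹‖ ≤ 1 / c * ‖w⁻¹‖ ^ m := by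
    filter_upwards [hgk.filter_mono nhdsWithin_le_nhds, hkc.filter_mono nhdsWithin_le_nhds,
      hlarge 0, self_mem_nhdsWithin] with w h1 h2 h3 h4
    rw [hgw w h4, sub_zero, smul_eq_mul] at h1
    have h5 := congrArg norm h1
    rw [norm_inv, norm_mul, norm_pow] at h5
    have hw : 0 < ‖w‖ := norm_pos_iff.2 h4
    rw [inv_eq_iff_eq_inv] at h5
    rw [h5, norm_inv, mul_inv, mul_comm, inv_pow, one_div]
    gcongr
  have htail : ∀ᶠ z in Bornology.cobounded ℂ, ‖f z‖ ≤ 1 / c * ‖z‖ ^ m := by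
    have := tendsto_inv₀_cobounded (α := ℂ)
    have h2 : Tendsto (fun z : ℂ => z⁻¹) (Bornology.cobounded ℂ) (𝓝[≠] 0) := by
      rw [tendsto_nhdsWithin_iff]
      refine ⟨this, ?_⟩
      filter_upwards [Bornology.eventually_ne_cobounded (0 : ℂ)] with z hz using inv_ne_zero hz
    simpa using h2.eventually hall
  obtain ⟨j, hj, hne⟩ := exists_iteratedDeriv_ne_zero hf htrans m
  rw [← comap_norm_atTop, eventually_comap] at htail
  have hj0 : 0 < ‖iteratedDeriv j f 0‖ := norm_pos_iff.2 hne
  set q := j.factorial * (1 / c) / ‖iteratedDeriv j f 0‖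
  obtain ⟨R, h1, h2, h3⟩ := (htail.and ((eventually_gt_atTop (1 : ℝ)).and
    (eventually_gt_atTop q))).exists
  have hR0 : 0 < R := by linarith
  have h4 := norm_iteratedDeriv_le_of_entire hf hR0 (M := 1 / c * R ^ m)
    (fun z hz => by have := h1 z hz; rwa [hz] at this) j
  have h5 : R ^ (m + 1) ≤ R ^ j := pow_le_pow_right₀ h2.le hj
  rw [le_div_iff₀ (by positivity)] at h4
  have h6 : ‖iteratedDeriv j f 0‖ * R * R ^ m ≤ j.factorial * (1 / c) * R ^ m := by
    calc _ = ‖iteratedDeriv j f 0‖ * R ^ (m + 1) := by ring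
      _ ≤ ‖iteratedDeriv j f 0‖ * R ^ j := by gcongr
      _ ≤ _ := by linarith
  have h7 := le_of_mul_le_mul_right h6 (by positivity)
  rw [div_lt_iff₀ hj0] at h3
  linarith

/-- Points `x R` of least modulus at which `‖f‖` takes the value `R`. -/
theorem exists_extremal_points {f : ℂ → ℂ} (hf : Differentiable ℂ f)
    (htrans : ¬ ∃ p : Polynomial ℂ, ∀ z : ℂ, f z = p.eval z) :
    ∃ x : ℝ → ℂ, (∀ᶠ R in atTop, ‖f (x R)‖ = R ∧ ∀ z, ‖z‖ ≤ ‖x R‖ → ‖f z‖ ≤ R) ∧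
      Tendsto (fun R => ‖x R‖) atTop atTop ∧
      ∀ j : ℕ, Tendsto (fun R => ‖x R‖ ^ j / R) atTop (𝓝 0) := by
  have hunb : ∀ R : ℝ, ∃ z, R < ‖f z‖ := by
    by_contra! h
    obtain ⟨R, hR⟩ := h
    have : ∀ z, f z = f 0 := fun z => hf.apply_eq_apply_of_bounded
      ((isBounded_iff_forall_norm_le).2 ⟨R, by rintro _ ⟨w, rfl⟩; exact hR w⟩) z 0
    exact htrans ⟨Polynomial.C (f 0), fun z => by simp [this z]⟩
  have hex : ∀ R : ℝ, ∃ x : ℂ, ‖f 0‖ < R → ‖f x‖ = R ∧ ∀ z, ‖z‖ ≤ ‖x‖ → ‖f z‖ ≤ R := by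
    intro R
    by_cases hR : ‖f 0‖ < R
    swap
    · exact ⟨0, fun h => absurd h hR⟩
    obtain ⟨z₁, hz₁⟩ := hunb R
    have hcl : IsClosed {z | R ≤ ‖f z‖} := isClosed_le continuous_const hf.continuous.norm
    obtain ⟨x, hx, hmin⟩ := hcl.exists_infDist_eq_dist ⟨z₁, hz₁.le⟩ 0
    have hlt : ∀ z, ‖z‖ < ‖x‖ → ‖f z‖ < R := by
      intro z hz
      by_contra! hle
      have := infDist_le_dist_of_mem (x := (0 : ℂ)) (show z ∈ {z | R ≤ ‖f z‖} from hle)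
      rw [hmin, dist_zero_left, dist_zero_left] at this
      linarith
    have hx0 : x ≠ 0 := by
      rintro rfl
      exact absurd hx (not_le.2 hR)
    have hle : ∀ z, ‖z‖ ≤ ‖x‖ → ‖f z‖ ≤ R := by
      intro z hz
      have h1 : z ∈ closure (ball (0 : ℂ) ‖x‖) := by
        rw [closure_ball _ (norm_ne_zero_iff.2 hx0)]; simpa using hz
      have h2 : IsClosed {z | ‖f z‖ ≤ R} := isClosed_le hf.continuous.norm continuous_const
      refine h2.closure_subset_iff.2 ?_ h1
      intro w hw
      exact (hlt w (by simpa using hw)).le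
    exact ⟨x, fun _ => ⟨le_antisymm (hle x le_rfl) hx, hle⟩⟩
  choose x hx using hex
  have hev : ∀ᶠ R in atTop, ‖f (x R)‖ = R ∧ ∀ z, ‖z‖ ≤ ‖x R‖ → ‖f z‖ ≤ R :=
    (eventually_gt_atTop ‖f 0‖).mono fun R hR => hx R hR
  have hX : Tendsto (fun R => ‖x R‖) atTop atTop := by
    rw [Filter.tendsto_atTop]
    intro B
    obtain ⟨M, hM⟩ := (isCompact_closedBall (0 : ℂ) B).exists_bound_of_continuousOn
      hf.continuous.continuousOn
    filter_upwards [hev, eventually_gt_atTop M] with R h1 h2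
    by_contra! hlt
    have := hM (x R) (by simpa using hlt.le)
    linarith [h1.1]
  refine ⟨x, hev, hX, fun j => ?_⟩
  obtain ⟨i, hi, hne⟩ := exists_iteratedDeriv_ne_zero hf htrans j
  have hi0 : 0 < ‖iteratedDeriv i f 0‖ := norm_pos_iff.2 hne
  set q := i.factorial / ‖iteratedDeriv i f 0‖
  have h0 : Tendsto (fun R => q * ‖x R‖⁻¹) atTop (𝓝 0) := by
    simpa using (tendsto_inv_atTop_zero.comp hX).const_mul q
  refine squeeze_zero' ?_ ?_ h0
  · filter_upwards [eventually_gt_atTop 0] with R hR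
    positivity
  · filter_upwards [hev, eventually_gt_atTop 0, hX.eventually_gt_atTop 1] with R h1 h2 h3
    have hX0 : 0 < ‖x R‖ := by linarith
    have h4 := norm_iteratedDeriv_le_of_entire hf hX0 (M := R)
      (fun z hz => h1.2 z hz.le) i
    have h5 : ‖x R‖ ^ (j + 1) ≤ ‖x R‖ ^ i := pow_le_pow_right₀ h3.le hi
    rw [le_div_iff₀ (by positivity)] at h4
    rw [div_le_iff₀ h2, ← div_eq_mul_inv, div_mul_eq_mul_div, le_div_iff₀ hX0,
      div_mul_eq_mul_div, le_div_iff₀ hi0]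
    calc ‖x R‖ ^ j * ‖x R‖ * ‖iteratedDeriv i f 0‖
        = ‖iteratedDeriv i f 0‖ * ‖x R‖ ^ (j + 1) := by ring
      _ ≤ ‖iteratedDeriv i f 0‖ * ‖x R‖ ^ i := by gcongr
      _ ≤ _ := h4

theorem eventually_exists_large {f : ℂ → ℂ} (hf : Differentiable ℂ f)
    (htrans : ¬ ∃ p : Polynomial ℂ, ∀ z : ℂ, f z = p.eval z) :
    ∀ᶠ R : ℝ in atTop, ∃ z, ‖z‖ = R ∧ R ^ 2 ≤ ‖f z‖ := by
  obtain ⟨i, hi, hne⟩ := exists_iteratedDeriv_ne_zero hf htrans 2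
  have hi0 : 0 < ‖iteratedDeriv i f 0‖ := norm_pos_iff.2 hne
  filter_upwards [eventually_gt_atTop 1,
    eventually_gt_atTop (i.factorial / ‖iteratedDeriv i f 0‖)] with R h2 h3
  by_contra! hcon
  have hR0 : 0 < R := by linarith
  have h4 := norm_iteratedDeriv_le_of_entire hf hR0 (M := R ^ 2) (fun z hz => (hcon z hz).le) i
  have h5 : R ^ 3 ≤ R ^ i := pow_le_pow_right₀ h2.le hi
  rw [le_div_iff₀ (by positivity)] at h4
  rw [div_lt_iff₀ hi0] at h3
  have h6 : ‖iteratedDeriv i f 0‖ * R * R ^ 2 ≤ i.factorial * R ^ 2 := by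
    calc _ = ‖iteratedDeriv i f 0‖ * R ^ 3 := by ring
      _ ≤ ‖iteratedDeriv i f 0‖ * R ^ i := by gcongr
      _ ≤ _ := h4
  have h7 := le_of_mul_le_mul_right h6 (by positivity)
  linarith

/-- `z` is a blow-up point of the family `Φ`: no local growth bound holds near `z`. -/
def Blow {ι : Type*} (l : Filter ι) (Φ : ι → ℂ → ℂ) (z : ℂ) : Prop :=
  ∀ ε > 0, ∀ C : ℝ, ∀ᶠ i in l, ∃ w ∈ ball z ε, C * (1 + ‖Φ i w‖) ^ 5 < ‖deriv (Φ i) w‖ ^ 4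

theorem tame_of_not_blow {ι : Type*} {U : Ultrafilter ι} {Φ : ι → ℂ → ℂ}
    (hΦ : ∀ i, Differentiable ℂ (Φ i)) {z : ℂ} (h : ¬ Blow U Φ z) : Tame U Φ z := by
  unfold Blow at h
  push Not at h
  obtain ⟨ε, hε, C, h⟩ := h
  refine ⟨ε, hε, C, ?_⟩
  have h' : ∀ᶠ i in (U : Filter ι),
      ∀ w ∈ ball z ε, ‖deriv (Φ i) w‖ ^ 4 ≤ C * (1 + ‖Φ i w‖) ^ 5 := by
    simpa using h
  filter_upwards [h'] with i hi
  exact ⟨(hΦ i).differentiableOn, hi⟩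

theorem exists_bound_closedBall {ι : Type*} {l : Filter ι} {Φ : ι → ℂ → ℂ}
    (hΦ : ∀ i, Differentiable ℂ (Φ i)) {c : ℂ} {ρ : ℝ} (hρ : 0 < ρ)
    (h : ∀ z ∈ sphere c ρ, LocBdd l Φ z) :
    ∃ K : ℝ, ∀ᶠ i in l, ∀ z ∈ closedBall c ρ, ‖Φ i z‖ ≤ K := by
  have key : ∃ K : ℝ, ∀ᶠ i in l, ∀ z ∈ sphere c ρ, ‖Φ i z‖ ≤ K := by
    refine (isCompact_sphere c ρ).induction_on (p := fun s => ∃ K : ℝ, ∀ᶠ i in l, ∀ z ∈ s,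
      ‖Φ i z‖ ≤ K) ⟨0, by simp⟩ ?_ ?_ ?_
    · rintro s t hst ⟨K, hK⟩
      exact ⟨K, hK.mono fun i hi z hz => hi z (hst hz)⟩
    · rintro s t ⟨K, hK⟩ ⟨K', hK'⟩
      refine ⟨max K K', ?_⟩
      filter_upwards [hK, hK'] with i h1 h2 z hz
      rcases hz with hz | hz
      · exact (h1 z hz).trans (le_max_left _ _)
      · exact (h2 z hz).trans (le_max_right _ _)
    · intro z hz
      obtain ⟨ε, hε, K, hK⟩ := h z hz
      exact ⟨ball z ε, mem_nhdsWithin_of_mem_nhds (ball_mem_nhds z hε), K,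
        hK.mono fun i hi => hi.2⟩
  obtain ⟨K, hK⟩ := key
  refine ⟨K, hK.mono fun i hi z hz => ?_⟩
  refine norm_le_of_forall_mem_frontier_norm_le isBounded_ball (hΦ i).diffContOnCl
    (U := ball c ρ) ?_ (by rwa [closure_ball _ hρ.ne'])
  rwa [frontier_ball _ hρ.ne']

theorem exists_sphere_disjoint {S : Set ℂ} (hS : S.Finite) (c : ℂ) {r s : ℝ} (hrs : r < s) :
    ∃ t ∈ Ioo r s, ∀ z ∈ sphere c t, z ∉ S := by
  obtain ⟨t, ht, hn⟩ := (Ioo_infinite hrs).exists_notMem_finite (hS.image (dist · c))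
  exact ⟨t, ht, fun z hz hzS => hn ⟨z, hzS, hz⟩⟩

theorem Blow.eventually_exists_large {ι : Type*} {l : Filter ι} {Φ : ι → ℂ → ℂ} {z : ℂ}
    (h : Blow l Φ z) {ε : ℝ} (hε : 0 < ε) (C : ℝ) {η : ℝ} (hη : 0 < η) :
    ∀ᶠ i in l, ∃ w ∈ ball z ε, C * (1 + ‖Φ i w‖) ^ 5 ≤ η ^ 4 * ‖deriv (Φ i) w‖ ^ 4 := by
  filter_upwards [h ε hε (C / η ^ 4)] with i hi
  obtain ⟨w, hw, hi⟩ := hi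
  refine ⟨w, hw, ?_⟩
  have : C / η ^ 4 * (1 + ‖Φ i w‖) ^ 5 * η ^ 4 ≤ ‖deriv (Φ i) w‖ ^ 4 * η ^ 4 := by gcongr
  rw [mul_comm (η ^ 4)]
  refine le_trans (le_of_eq ?_) this
  field_simp

theorem exists_island_near_blow {S : Finset ℂ} (hS : S.card = 3) :
    ∃ δ > 0, ∀ {ι : Type} {l : Filter ι} {Φ : ι → ℂ → ℂ} {b : ℂ} {ε : ℝ},
      (∀ i, Differentiable ℂ (Φ i)) → Blow l Φ b → 0 < ε →
      ∀ᶠ i in l, ∃ a ∈ S, ∃ h : ℂ → ℂ, DifferentiableOn ℂ h (ball a δ) ∧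
        ∀ w ∈ ball a δ, h w ∈ ball b ε ∧ Φ i (h w) = w := by
  obtain ⟨δ, hδ, C, hC, H⟩ := exists_island hS
  refine ⟨δ, hδ, fun {ι l Φ b ε} hΦ hb hε => ?_⟩
  filter_upwards [hb.eventually_exists_large (half_pos hε) C (half_pos hε)] with i hi
  obtain ⟨z, hz, hi⟩ := hi
  obtain ⟨a, ha, h, hd, hh⟩ := H (Φ i) z (ε / 2) (half_pos hε) (hΦ i).differentiableOn hi
  refine ⟨a, ha, h, hd, fun w hw => ⟨?_, (hh w hw).2⟩⟩
  have := (hh w hw).1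
  rw [mem_ball] at *
  linarith [dist_triangle (h w) z b]

theorem exists_island_near_blow_of_ne_zero {a : ℂ} (ha : a ≠ 0) :
    ∃ δ > 0, ∀ {ι : Type} {l : Filter ι} {Φ : ι → ℂ → ℂ} {b : ℂ} {ε ε₀ : ℝ},
      (∀ i, Differentiable ℂ (Φ i)) → Blow l Φ b → 0 < ε₀ →
      (∀ᶠ i in l, ∀ z ∈ ball b ε₀, Φ i z ≠ 0) → 0 < ε →
      ∀ᶠ i in l, ∃ h : ℂ → ℂ, DifferentiableOn ℂ h (ball a δ) ∧
        ∀ w ∈ ball a δ, h w ∈ ball b ε ∧ Φ i (h w) = w := by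
  obtain ⟨δ, hδ, C, hC, H⟩ := exists_island_of_ne_zero ha
  refine ⟨δ, hδ, fun {ι l Φ b ε ε₀} hΦ hb hε₀ hne hε => ?_⟩
  have hη : 0 < min ε ε₀ / 2 := by positivity
  filter_upwards [hb.eventually_exists_large hη C hη, hne] with i hi hne
  obtain ⟨z, hz, hi⟩ := hi
  have hsub : ∀ w ∈ ball z (min ε ε₀ / 2), dist w b < min ε ε₀ := fun w hw => by
    rw [mem_ball] at *
    linarith [dist_triangle w z b]
  obtain ⟨h, hd, hh⟩ := H (Φ i) z _ hη (hΦ i).differentiableOn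
    (fun w hw => hne w ((hsub w hw).trans_le (min_le_right _ _))) hi
  exact ⟨h, hd, fun w hw => ⟨(hsub _ (hh w hw).1).trans_le (min_le_left _ _), (hh w hw).2⟩⟩

/-- The family of rescalings `z ↦ f (s z) / r` of `f`. -/
noncomputable def rescaled (f : ℂ → ℂ) (s r : ℝ → ℝ) (R : ℝ) (z : ℂ) : ℂ :=
  f ((s R : ℂ) * z) / (r R : ℂ)

/-- `x R` is a point of smallest modulus where `‖f‖` takes the value `R`, for large `R`;
its modulus tends to infinity, and more slowly than every power of `R`. -/
def IsExtremal (f : ℂ → ℂ) (x : ℝ → ℂ) : Prop :=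
  (∀ᶠ R in atTop, ‖f (x R)‖ = R ∧ ∀ z, ‖z‖ ≤ ‖x R‖ → ‖f z‖ ≤ R) ∧
    Tendsto (fun R => ‖x R‖) atTop atTop ∧
    ∀ j : ℕ, Tendsto (fun R => ‖x R‖ ^ j / R) atTop (𝓝 0)

theorem differentiable_rescaled {f : ℂ → ℂ} (hf : Differentiable ℂ f) (s r : ℝ → ℝ) (R : ℝ) :
    Differentiable ℂ (rescaled f s r R) :=
  (hf.comp (differentiable_id.const_mul (s R : ℂ))).div_const _

theorem infinite_setOf_blow {f : ℂ → ℂ} (hf : Differentiable ℂ f) {x : ℝ → ℂ}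
    (hx : IsExtremal f x) {U : Ultrafilter ℝ} (hU : (U : Filter ℝ) ≤ atTop) :
    {z : ℂ | 1 / 2 < ‖z‖ ∧ ‖z‖ < 2 ∧ Blow U (rescaled f (‖x ·‖) id) z}.Infinite := by
  intro hfin
  set φ := rescaled f (‖x ·‖) id with hφ
  have hφd : ∀ R, Differentiable ℂ (φ R) := differentiable_rescaled hf _ _
  obtain ⟨hext, hX, hpow⟩ := hx
  set β : ℝ → ℂ := fun R => x R / (‖x R‖ : ℂ) with hβ
  have hXpos : ∀ᶠ R in (U : Filter ℝ), 0 < ‖x R‖ := hU (hX.eventually_gt_atTop 0)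
  have hRpos : ∀ᶠ R in (U : Filter ℝ), 0 < R := hU (eventually_gt_atTop 0)
  have hβ1 : ∀ᶠ R in (U : Filter ℝ), ‖β R‖ = 1 := by
    filter_upwards [hXpos] with R hR
    simp only [hβ, norm_div, Complex.norm_real, norm_norm]
    exact div_self hR.ne'
  obtain ⟨b, -, hb⟩ := (isCompact_sphere (0 : ℂ) 1).ultrafilter_le_nhds (U.map β)
    (by
      rw [le_principal_iff]
      exact hβ1.mono fun R hR => by simpa using hR)
  have hbt : Tendsto β U (𝓝 b) := hb
  have hb1 : ‖b‖ = 1 :=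
    tendsto_nhds_unique hbt.norm (tendsto_const_nhds.congr' (hβ1.mono fun R h => h.symm))
  have hunit : ∀ᶠ R in (U : Filter ℝ), ∀ z, ‖z‖ ≤ 1 → ‖φ R z‖ ≤ 1 := by
    filter_upwards [hU hext, hRpos, hXpos] with R h1 h2 h3 z hz
    have := h1.2 ((‖x R‖ : ℂ) * z) (by
      rw [norm_mul, Complex.norm_real, norm_norm]
      exact mul_le_of_le_one_right h3.le hz)
    simp only [hφ, rescaled, id, norm_div, Complex.norm_real, Real.norm_of_nonneg h2.le]
    exact (div_le_one h2).2 this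
  have hval : ∀ᶠ R in (U : Filter ℝ), ‖φ R (β R)‖ = 1 := by
    filter_upwards [hU hext, hRpos, hXpos] with R h1 h2 h3
    have h4 : (‖x R‖ : ℂ) ≠ 0 := by exact_mod_cast h3.ne'
    simp only [hφ, rescaled, id, norm_div, Complex.norm_real, Real.norm_of_nonneg h2.le, hβ,
      mul_div_cancel₀ _ h4, h1.1]
    exact div_self h2.ne'
  obtain ⟨t, ⟨ht0, ht1⟩, hts⟩ := exists_sphere_disjoint hfin b (show (0 : ℝ) < 1 / 2 by norm_num)
  have hnormsph : ∀ z, dist z b ≤ t → 1 / 2 < ‖z‖ ∧ ‖z‖ < 2 := by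
    intro z hz
    rw [dist_eq_norm] at hz
    constructor
    · linarith [norm_sub_norm_le b z, norm_sub_rev b z]
    · linarith [norm_sub_norm_le z b]
  have htame : ∀ z ∈ sphere b t, Tame U φ z := by
    intro z hz
    have h1 := hnormsph z (mem_sphere.1 hz).le
    exact tame_of_not_blow hφd fun hbl => hts z hz ⟨h1.1, h1.2, hbl⟩
  have hscale : ∀ s : ℝ, dist ((1 - s : ℝ) * b) b = |s| := by
    intro s
    rw [dist_eq_norm, show ((1 - s : ℝ) : ℂ) * b - b = ((-s : ℝ) : ℂ) * b by push_cast; ring,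
      norm_mul, hb1, mul_one, Complex.norm_real, Real.norm_eq_abs, abs_neg]
  have hscale' : ∀ s : ℝ, s ≤ 1 → ‖((1 - s : ℝ) : ℂ) * b‖ = 1 - s := by
    intro s hs
    rw [norm_mul, hb1, mul_one, Complex.norm_real, Real.norm_of_nonneg (by linarith)]
  have hsph : ∀ z ∈ sphere b t, LocBdd U φ z := by
    refine LocBdd.of_preconnected (isPreconnected_sphere (by
      rw [Complex.rank_real_complex]; norm_num) b t) htame (z₀ := ((1 - t : ℝ) : ℂ) * b)
      (K := 1) ?_ ?_
    · rw [mem_sphere, hscale, abs_of_pos ht0]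
    · filter_upwards [hunit] with R hR
      exact hR _ (by rw [hscale' t (by linarith)]; linarith)
  obtain ⟨K, hK⟩ := exists_bound_closedBall hφd ht0 hsph
  have hbd : ∀ z ∈ ball (0 : ℂ) 1 ∪ ball b t, LocBdd U φ z := by
    rintro z (hz | hz)
    · refine ⟨1 - ‖z‖, by simpa using hz, 1, ?_⟩
      filter_upwards [hunit] with R hR
      refine ⟨(hφd R).differentiableOn, fun w hw => hR w ?_⟩
      rw [mem_ball, dist_eq_norm] at hw
      linarith [norm_sub_norm_le w z]
    · refine ⟨t - dist z b, by simpa using hz, K, ?_⟩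
      filter_upwards [hK] with R hR
      refine ⟨(hφd R).differentiableOn, fun w hw => hR w ?_⟩
      rw [mem_ball] at hw
      rw [mem_closedBall]
      linarith [dist_triangle w z b]
  obtain ⟨g, hg⟩ := LocBdd.exists_limit (U := U) (Φ := φ)
  have hgd : DifferentiableOn ℂ g (ball (0 : ℂ) 1 ∪ ball b t) := fun z hz =>
    (hg z (hbd z hz)).differentiableAt.differentiableWithinAt
  have hzero : ∀ j, iteratedDeriv j g 0 = 0 := by
    intro j
    have h1 := ((hg 0 (hbd 0 (Or.inl (mem_ball_self one_pos)))).iteratedDeriv j).tendsto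
    refine tendsto_nhds_unique h1 ?_
    have h2 : ∀ R, iteratedDeriv j (φ R) 0 =
        ((‖x R‖ ^ j / R : ℝ) : ℂ) * iteratedDeriv j f 0 := by
      intro R
      have e1 : φ R = fun z => (fun z => f ((‖x R‖ : ℂ) * z)) z / (R : ℂ) := rfl
      rw [e1, iteratedDeriv_div_const, iteratedDeriv_comp_const_mul hf.contDiff]
      push_cast
      rw [mul_zero]
      ring
    simp_rw [h2]
    have h3 := (Complex.continuous_ofReal.tendsto 0).comp ((hpow j).mono_left hU)
    simpa [Function.comp_def] using h3.mul_const (iteratedDeriv j f 0)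
  have hg0 : ∀ z ∈ ball (0 : ℂ) 1, g z = 0 := by
    intro z hz
    have := Complex.hasSum_taylorSeries_on_ball (hgd.mono subset_union_left) hz
    simp only [hzero, smul_zero] at this
    exact this.unique hasSum_zero
  have hpre : IsPreconnected (ball (0 : ℂ) 1 ∪ ball b t) := by
    refine IsPreconnected.union (((1 - t / 2 : ℝ) : ℂ) * b) ?_ ?_
      (convex_ball _ _).isPreconnected (convex_ball _ _).isPreconnected
    · rw [mem_ball_zero_iff, hscale' _ (by linarith)]; linarith
    · rw [mem_ball, hscale, abs_of_pos (by linarith)]; linarith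
  have han := hgd.analyticOnNhd (isOpen_ball.union isOpen_ball)
  have hEq := han.eqOn_zero_of_preconnected_of_eventuallyEq_zero
    hpre (Or.inl (mem_ball_self one_pos))
    ((isOpen_ball.eventually_mem (mem_ball_self one_pos)).mono fun z hz => hg0 z hz)
  have hbU : b ∈ ball (0 : ℂ) 1 ∪ ball b t := Or.inr (mem_ball_self ht0)
  have h1 := ((hg b (hbd b hbU)).tendsto_comp hbt).norm
  rw [hEq hbU] at h1
  have h2 := tendsto_nhds_unique h1 (tendsto_const_nhds.congr' (hval.mono fun R h => h.symm))
  simp at h2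

theorem exists_escape {f : ℂ → ℂ} (hf : Differentiable ℂ f)
    (htrans : ¬ ∃ p : Polynomial ℂ, ∀ z : ℂ, f z = p.eval z) {r : ℝ → ℝ} {U : Ultrafilter ℝ}
    (hU : (U : Filter ℝ) ≤ atTop) (hr : ∀ᶠ R in (U : Filter ℝ), 0 < r R ∧ r R ≤ R) {S : Set ℂ}
    (hS : S.Finite) (hblow : ∀ z, z ≠ 0 → z ∉ S → ¬ Blow U (rescaled f id r) z) {z : ℂ}
    (hz : z ≠ 0) (hzS : z ∉ S) :
    ∃ ε > 0, ∀ K : ℝ, ∀ᶠ R in (U : Filter ℝ), ∀ w ∈ ball z ε, K < ‖rescaled f id r R w‖ := by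
  have hd : ∀ R, Differentiable ℂ (rescaled f id r R) := differentiable_rescaled hf _ _
  refine (tame_of_not_blow hd (hblow z hz hzS)).escape fun K => ?_
  by_contra hcon
  rw [← Ultrafilter.eventually_not] at hcon
  have hS0 : (insert 0 S).Finite := hS.insert 0
  have hD : IsPreconnected (insert 0 S)ᶜ :=
    (hS0.countable.isConnected_compl_of_one_lt_rank (by
      rw [Complex.rank_real_complex]; norm_num)).isPreconnected
  have hloc := LocBdd.of_preconnected hD (Φ := rescaled f id r) (U := U) (K := K)
    (fun w hw => tame_of_not_blow hd (hblow w (fun h => hw (Or.inl h)) fun h => hw (Or.inr h)))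
    (z₀ := z) (by rintro (h | h); exacts [hz h, hzS h]) (hcon.mono fun R h => not_lt.1 h)
  obtain ⟨t, ⟨ht1, -⟩, hts⟩ := exists_sphere_disjoint hS0 0 (show (1 : ℝ) < 2 by norm_num)
  obtain ⟨K', hK'⟩ := exists_bound_closedBall hd (one_pos.trans ht1)
    fun w hw => hloc w (hts w hw)
  obtain ⟨R, h1, h2, h3, h4⟩ := (hK'.and (hr.and
    (((eventually_exists_large hf htrans).filter_mono hU).and
    ((eventually_gt_atTop (max K' 0)).filter_mono hU)))).exists
  obtain ⟨w, hw, hw2⟩ := h3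
  have hR : 0 < R := (le_max_right _ _).trans_lt h4
  have hRK : K' < R := (le_max_left _ _).trans_lt h4
  have hRC : (R : ℂ) ≠ 0 := by exact_mod_cast hR.ne'
  have h5 := h1 (w / (R : ℂ)) (by
    rw [mem_closedBall_zero_iff, norm_div, Complex.norm_real, Real.norm_of_nonneg hR.le, hw,
      div_self hR.ne']
    exact ht1.le)
  simp only [rescaled, id, mul_div_cancel₀ _ hRC, norm_div, Complex.norm_real,
    Real.norm_of_nonneg h2.1.le] at h5
  rw [div_le_iff₀ h2.1] at h5
  nlinarith [h2.1, h2.2]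

/-- For every `N` there are `N` points `b` in the annulus `1/2 < ‖b‖ < 2` such that, for large `R`,
`f^[m]` maps small domains near `X^[m] R * b` conformally onto discs around some `R * a`, `a ∈ A`,
in such a way that all intermediate images are larger in modulus than the starting point. -/
def Covers (f : ℂ → ℂ) (X : ℝ → ℝ) (U : Ultrafilter ℝ) (A : Finset ℂ) (m : ℕ) : Prop :=
  ∀ N : ℕ, ∃ B : Finset ℂ, B.card = N ∧ (∀ b ∈ B, 1 / 2 < ‖b‖ ∧ ‖b‖ < 2) ∧ ∃ δ > 0, ∀ ε > 0,
    ∀ᶠ R in (U : Filter ℝ), ∀ b ∈ B, ∃ a ∈ A, ∃ h : ℂ → ℂ, DifferentiableOn ℂ h (ball a δ) ∧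
      ∀ w ∈ ball a δ, h w ∈ ball b ε ∧
        f^[m] ((X^[m] R : ℝ) * h w) = R * w ∧
        ∀ j, 1 ≤ j → j ≤ m → ‖((X^[m] R : ℝ) : ℂ) * h w‖ < ‖f^[j] ((X^[m] R : ℝ) * h w)‖

theorem IsExtremal.tendsto_iterate {f : ℂ → ℂ} {x : ℝ → ℂ} (hx : IsExtremal f x) (m : ℕ) :
    Tendsto (fun R : ℝ => (fun R => ‖x R‖)^[m] R) atTop atTop :=
  hx.2.1.iterate m

theorem IsExtremal.eventually_mul_lt {f : ℂ → ℂ} {x : ℝ → ℂ} (hx : IsExtremal f x) {c : ℝ}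
    (hc : 0 < c) : ∀ᶠ R in atTop, ‖x R‖ < c * R := by
  filter_upwards [(hx.2.2 1).eventually_lt_const hc, eventually_gt_atTop 0] with R h1 h2
  rwa [pow_one, div_lt_iff₀ h2] at h1

theorem IsExtremal.eventually_iterate_le {f : ℂ → ℂ} {x : ℝ → ℂ} (hx : IsExtremal f x) (m : ℕ) :
    ∀ᶠ R : ℝ in atTop, (fun R => ‖x R‖)^[m] R ≤ R := by
  induction m with
  | zero => simp
  | succ m ih =>
    filter_upwards [ih, (hx.tendsto_iterate m).eventually (hx.eventually_mul_lt one_pos)]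
      with R h1 h2
    rw [Function.iterate_succ_apply']
    linarith

theorem covers_one {f : ℂ → ℂ} {x : ℝ → ℂ} (hx : IsExtremal f x) {U : Ultrafilter ℝ}
    (hU : (U : Filter ℝ) ≤ atTop) {A : Finset ℂ} (hA : (0 : ℂ) ∉ A) {J : Set ℂ} (hJ : J.Infinite)
    (hJn : ∀ b ∈ J, 1 / 2 < ‖b‖ ∧ ‖b‖ < 2) {δ : ℝ} (hδ : 0 < δ)
    (H : ∀ b ∈ J, ∀ ε > 0, ∀ᶠ R in (U : Filter ℝ), ∃ a ∈ A, ∃ h : ℂ → ℂ,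
      DifferentiableOn ℂ h (ball a δ) ∧
        ∀ w ∈ ball a δ, h w ∈ ball b ε ∧ rescaled f (‖x ·‖) id R (h w) = w) :
    Covers f (‖x ·‖) U A 1 := by
  have hσ : ∃ σ > 0, ∀ a ∈ A, 2 * σ ≤ ‖a‖ := by
    obtain ⟨σ, hσ, h⟩ := exists_separation (insert 0 A)
    refine ⟨σ, hσ, fun a ha => ?_⟩
    have := h a (Finset.mem_insert_of_mem ha) 0 (Finset.mem_insert_self _ _)
      (fun h0 => hA (h0 ▸ ha))
    rwa [dist_zero_right] at this
  obtain ⟨σ, hσ, hσA⟩ := hσ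
  intro N
  obtain ⟨B, hBJ, hB⟩ := hJ.exists_subset_card_eq N
  refine ⟨B, hB, fun b hb => hJn b (hBJ hb), min δ σ, lt_min hδ hσ, fun ε hε => ?_⟩
  have h1 : ∀ᶠ R in (U : Filter ℝ), ∀ b ∈ B, ∃ a ∈ A, ∃ h : ℂ → ℂ,
      DifferentiableOn ℂ h (ball a δ) ∧
        ∀ w ∈ ball a δ, h w ∈ ball b (min ε 1) ∧ rescaled f (‖x ·‖) id R (h w) = w :=
    (Filter.eventually_all_finset B).2 fun b hb => H b (hBJ hb) _ (lt_min hε one_pos)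
  filter_upwards [h1, hU (eventually_gt_atTop 0),
    hU (hx.eventually_mul_lt (c := σ / 3) (by positivity))] with R hR hR0 hRX b hb
  obtain ⟨a, ha, h, hd, hh⟩ := hR b hb
  refine ⟨a, ha, h, hd.mono (ball_subset_ball (min_le_left _ _)), fun w hw => ?_⟩
  obtain ⟨hw1, hw2⟩ := hh w (ball_subset_ball (min_le_left _ _) hw)
  have hRC : (R : ℂ) ≠ 0 := by exact_mod_cast hR0.ne'
  have hval : f ((‖x R‖ : ℝ) * h w) = R * w := by
    rw [rescaled, div_eq_iff (by exact_mod_cast hR0.ne')] at hw2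
    rw [hw2, mul_comm]
    rfl
  refine ⟨ball_subset_ball (min_le_left _ _) hw1, by simpa using hval, fun j hj1 hj2 => ?_⟩
  obtain rfl : j = 1 := le_antisymm hj2 hj1
  simp only [Function.iterate_one]
  rw [hval, norm_mul, norm_mul, Complex.norm_real, Complex.norm_real, norm_norm,
    Real.norm_of_nonneg hR0.le]
  have e1 : ‖h w‖ < 3 := by
    have := (mem_ball.1 hw1).trans_le (min_le_right _ _)
    rw [dist_eq_norm] at this
    linarith [norm_sub_norm_le (h w) b, (hJn b (hBJ hb)).2]
  have e2 : σ ≤ ‖w‖ := by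
    have := (mem_ball.1 hw).trans_le (min_le_right _ _)
    rw [dist_eq_norm] at this
    linarith [norm_sub_norm_le a w, norm_sub_rev a w, hσA a ha]
  calc ‖x R‖ * ‖h w‖ ≤ ‖x R‖ * 3 := by gcongr
    _ < σ / 3 * R * 3 := by gcongr
    _ = R * σ := by ring
    _ ≤ R * ‖w‖ := by gcongr

theorem covers_one_of_card_eq_three {f : ℂ → ℂ} (hf : Differentiable ℂ f) {x : ℝ → ℂ}
    (hx : IsExtremal f x) {U : Ultrafilter ℝ} (hU : (U : Filter ℝ) ≤ atTop) {A : Finset ℂ}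
    (hA : (0 : ℂ) ∉ A) (hA3 : A.card = 3) : Covers f (‖x ·‖) U A 1 := by
  obtain ⟨δ, hδ, H⟩ := exists_island_near_blow hA3
  exact covers_one hx hU hA (infinite_setOf_blow hf hx hU) (fun b hb => ⟨hb.1, hb.2.1⟩) hδ
    fun b hb ε hε => H (differentiable_rescaled hf _ _) hb.2.2 hε

theorem Covers.succ {f : ℂ → ℂ} (hf : Differentiable ℂ f) {x : ℝ → ℂ}
    (hx : IsExtremal f x) {U : Ultrafilter ℝ} (hU : (U : Filter ℝ) ≤ atTop) {A : Finset ℂ} {m : ℕ}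
    (h : Covers f (‖x ·‖) U A m) : Covers f (‖x ·‖) U A (m + 1) := by
  obtain ⟨B₃, hB₃, hB₃n, δ₃, hδ₃, H⟩ := h 3
  have h0 : (0 : ℂ) ∉ B₃ := fun h0 => by
    have := (hB₃n 0 h0).1
    norm_num at this
  have hU' : ((U.map (fun R => (fun R => ‖x R‖)^[m] R) : Ultrafilter ℝ) : Filter ℝ) ≤ atTop :=
    (hx.tendsto_iterate m).mono_left hU
  intro N
  obtain ⟨B, hB, hBn, δ, hδ, H'⟩ := covers_one_of_card_eq_three hf hx hU' h0 hB₃ N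
  refine ⟨B, hB, hBn, δ₃, hδ₃, fun ε hε => ?_⟩
  have h2 := H' ε hε
  rw [Ultrafilter.coe_map, Filter.eventually_map] at h2
  filter_upwards [H δ hδ, h2] with R h1 h2 b hb
  obtain ⟨b', hb', h, hd, hh⟩ := h2 b hb
  obtain ⟨a, ha, h', hd', hh'⟩ := h1 b' hb'
  refine ⟨a, ha, h ∘ h', hd.comp hd' fun w hw => (hh' w hw).1, fun w hw => ?_⟩
  obtain ⟨e1, e2, e3⟩ := hh' w hw
  obtain ⟨e4, e5, e6⟩ := hh (h' w) e1
  rw [Function.iterate_one] at e5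
  have e7 := e6 1 le_rfl le_rfl
  have e8 : (fun R => ‖x R‖)^[1] ((fun R => ‖x R‖)^[m] R) = (fun R => ‖x R‖)^[m + 1] R := by
    rw [Function.iterate_one, Function.iterate_succ_apply']
  rw [e8] at e5 e7
  rw [Function.iterate_one] at e7
  refine ⟨e4, ?_, fun j hj1 hj2 => ?_⟩
  · rw [Function.iterate_succ_apply f m, Function.comp_apply, e5, e2]
  · obtain ⟨j, rfl⟩ : ∃ i, j = i + 1 := ⟨j - 1, by omega⟩
    rw [Function.iterate_succ_apply f j, Function.comp_apply]
    rcases Nat.eq_zero_or_pos j with rfl | hj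
    · exact e7
    · refine e7.trans ?_
      rw [e5]
      exact e3 j hj (by omega)

theorem Covers.of_one {f : ℂ → ℂ} (hf : Differentiable ℂ f) {x : ℝ → ℂ}
    (hx : IsExtremal f x) {U : Ultrafilter ℝ} (hU : (U : Filter ℝ) ≤ atTop) {A : Finset ℂ}
    (h : Covers f (‖x ·‖) U A 1) {m : ℕ} (hm : 1 ≤ m) : Covers f (‖x ·‖) U A m := by
  induction m, hm using Nat.le_induction with
  | base => exact h
  | succ m _ ih => exact ih.succ hf hx hU

theorem exists_ultrafilter_blow {f : ℂ → ℂ} (hf : Differentiable ℂ f)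
    (htrans : ¬ ∃ p : Polynomial ℂ, ∀ z : ℂ, f z = p.eval z) {r : ℝ → ℝ}
    (hr : ∀ᶠ R in atTop, 1 ≤ r R ∧ r R ≤ R) :
    ∃ U : Ultrafilter ℝ, (U : Filter ℝ) ≤ atTop ∧ ∃ z ≠ 0, Blow U (rescaled f id r) z := by
  by_contra! hcon
  obtain ⟨K, hK⟩ := exists_frequently_bounded hf htrans
  have hne : (atTop ⊓ 𝓟 {R : ℝ | ∃ z, ‖z‖ = R ∧ ‖f z‖ ≤ K}).NeBot :=
    frequently_mem_iff_neBot.1 hK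
  set U := Ultrafilter.of (atTop ⊓ 𝓟 {R : ℝ | ∃ z, ‖z‖ = R ∧ ‖f z‖ ≤ K})
  have hU := Ultrafilter.of_le (atTop ⊓ 𝓟 {R : ℝ | ∃ z, ‖z‖ = R ∧ ‖f z‖ ≤ K})
  have hUt : (U : Filter ℝ) ≤ atTop := hU.trans inf_le_left
  have hz : ∀ᶠ R in (U : Filter ℝ), ∃ z, ‖z‖ = R ∧ ‖f z‖ ≤ K :=
    le_principal_iff.1 (hU.trans inf_le_right)
  obtain ⟨ζ, hζ⟩ := hz.choice
  have hβ : ∀ᶠ R in (U : Filter ℝ), ζ R / (R : ℂ) ∈ sphere (0 : ℂ) 1 := by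
    filter_upwards [hζ, hUt (eventually_gt_atTop 0)] with R h1 h2
    rw [mem_sphere_zero_iff_norm, norm_div, h1.1, Complex.norm_real, Real.norm_of_nonneg h2.le,
      div_self h2.ne']
  obtain ⟨b, hb1, hb⟩ := (isCompact_sphere (0 : ℂ) 1).ultrafilter_le_nhds
    (U.map fun R => ζ R / (R : ℂ)) (le_principal_iff.2 hβ)
  have hbt : Tendsto (fun R => ζ R / (R : ℂ)) U (𝓝 b) := hb
  have hb0 : b ≠ 0 := by
    rintro rfl
    simp at hb1
  obtain ⟨ε, hε, h⟩ := exists_escape hf htrans hUt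
    ((hr.filter_mono hUt).mono fun R h => ⟨one_pos.trans_le h.1, h.2⟩) finite_empty
    (fun z hz _ => hcon U hUt z hz) hb0 (notMem_empty b)
  obtain ⟨R, h1, h2, h3, h4, h5⟩ := ((h |K|).and
    ((hbt.eventually_mem (ball_mem_nhds b hε)).and (hζ.and
    ((hr.filter_mono hUt).and ((eventually_gt_atTop 0).filter_mono hUt))))).exists
  have h6 := h1 _ h2
  have hRC : (R : ℂ) ≠ 0 := by exact_mod_cast h5.ne'
  have hr0 : 0 < r R := one_pos.trans_le h4.1
  simp only [rescaled, id, mul_div_cancel₀ _ hRC, norm_div, Complex.norm_real,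
    Real.norm_of_nonneg hr0.le] at h6
  rw [lt_div_iff₀ hr0] at h6
  nlinarith [abs_nonneg K, le_abs_self K, h3.2, h4.1]

theorem exists_covers {f : ℂ → ℂ} (hf : Differentiable ℂ f)
    (htrans : ¬ ∃ p : Polynomial ℂ, ∀ z : ℂ, f z = p.eval z) {x : ℝ → ℂ} (hx : IsExtremal f x)
    {m : ℕ} (hm : 1 ≤ m) :
    ∃ U : Ultrafilter ℝ, (U : Filter ℝ) ≤ atTop ∧ ∃ A : Finset ℂ,
      (∀ a ∈ A, Blow U (rescaled f id (fun R => ‖x R‖)^[m]) a) ∧ Covers f (‖x ·‖) U A m := by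
  have hr : ∀ᶠ R : ℝ in atTop, 1 ≤ (fun R => ‖x R‖)^[m] R ∧ (fun R => ‖x R‖)^[m] R ≤ R :=
    ((hx.tendsto_iterate m).eventually_ge_atTop 1).and (hx.eventually_iterate_le m)
  by_cases hcase : ∃ U : Ultrafilter ℝ, (U : Filter ℝ) ≤ atTop ∧ ∃ A : Finset ℂ, (0 : ℂ) ∉ A ∧
      A.card = 3 ∧ ∀ a ∈ A, Blow U (rescaled f id (fun R => ‖x R‖)^[m]) a
  · obtain ⟨U, hU, A, hA, hA3, hAb⟩ := hcase
    exact ⟨U, hU, A, hAb, (covers_one_of_card_eq_three hf hx hU hA hA3).of_one hf hx hU hm⟩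
  have hfin : ∀ U : Ultrafilter ℝ, (U : Filter ℝ) ≤ atTop →
      {z : ℂ | z ≠ 0 ∧ Blow U (rescaled f id (fun R => ‖x R‖)^[m]) z}.Finite := by
    intro U hU
    by_contra hinf
    obtain ⟨A, hA, hA3⟩ := Set.Infinite.exists_subset_card_eq hinf 3
    exact hcase ⟨U, hU, A, fun h0 => (hA h0).1 rfl, hA3, fun a ha => (hA ha).2⟩
  obtain ⟨U, hU, a, ha, hab⟩ := exists_ultrafilter_blow hf htrans hr
  refine ⟨U, hU, {a}, by simpa using hab, Covers.of_one hf hx hU ?_ hm⟩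
  have hU' : ((U.map (fun R => ‖x R‖) : Ultrafilter ℝ) : Filter ℝ) ≤ atTop :=
    hx.2.1.mono_left hU
  obtain ⟨δ, hδ, H⟩ := exists_island_near_blow_of_ne_zero ha
  refine covers_one hx hU (by simpa using ha.symm)
    ((infinite_setOf_blow hf hx hU).sdiff (hfin _ hU')) (fun b hb => ⟨hb.1.1, hb.1.2.1⟩) hδ ?_
  rintro b ⟨⟨hb1, hb2, hb⟩, hbS⟩ ε hε
  have hb0 : b ≠ 0 := by
    rintro rfl
    norm_num at hb1
  obtain ⟨ε₀, hε₀, hesc⟩ := exists_escape hf htrans hU'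
    ((hr.filter_mono hU').mono fun R h => ⟨one_pos.trans_le h.1, h.2⟩) (hfin _ hU')
    (fun z hz hzS hbl => hzS ⟨hz, hbl⟩) hb0 hbS
  have hne : ∀ᶠ R in (U : Filter ℝ), ∀ z ∈ ball b ε₀, rescaled f (‖x ·‖) id R z ≠ 0 := by
    have h1 := hesc 0
    rw [Ultrafilter.coe_map, Filter.eventually_map] at h1
    filter_upwards [h1, hU (eventually_gt_atTop 0)] with R h2 h3 z hz h0
    have h4 := norm_pos_iff.1 (h2 z hz)
    rw [rescaled, id, div_eq_zero_iff] at h0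
    rcases h0 with h0 | h0
    · exact h4 (by rw [rescaled, id, h0, zero_div])
    · exact h3.ne' (by exact_mod_cast h0)
  filter_upwards [H (differentiable_rescaled hf _ _) hb hε₀ hne hε] with R hR
  exact ⟨a, Finset.mem_singleton_self a, hR⟩

theorem exists_fixedPt_of_mapsTo_ball {K : ℂ → ℂ} {a : ℂ} {δ : ℝ} (hδ : 0 < δ)
    (hd : DifferentiableOn ℂ K (ball a δ)) (hm : ∀ w ∈ ball a δ, K w ∈ ball a (δ / 8)) :
    ∃ w ∈ ball a δ, K w = w ∧ ‖deriv K w‖ ≤ 1 / 4 := by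
  have hsub : closedBall a (δ / 4) ⊆ ball a δ := closedBall_subset_ball (by linarith)
  have hder : ∀ w ∈ closedBall a (δ / 4), ‖deriv K w‖ ≤ 1 / 4 := by
    intro w hw
    rw [mem_closedBall] at hw
    have h1 : closedBall w (δ / 2) ⊆ ball a δ := fun u hu => by
      rw [mem_closedBall] at hu
      rw [mem_ball]
      linarith [dist_triangle u w a]
    have h2 := norm_deriv_le_of_forall_mem_sphere_norm_le (f := fun u => K u - a) (c := w)
      (R := δ / 2) (C := δ / 8) (half_pos hδ)
      ((hd.mono h1).sub_const a |>.diffContOnCl_ball subset_rfl) fun u hu => by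
        rw [← dist_eq_norm]
        exact (hm u (h1 (sphere_subset_closedBall hu))).le
    rw [deriv_sub_const] at h2
    refine h2.trans (le_of_eq ?_)
    field_simp
    norm_num
  have hmaps : MapsTo K (closedBall a (δ / 4)) (closedBall a (δ / 4)) := fun w hw =>
    ball_subset_closedBall (ball_subset_ball (by linarith) (hm w (hsub hw)))
  have hlip : LipschitzOnWith (1 / 4) K (closedBall a (δ / 4)) := by
    refine (convex_closedBall a (δ / 4)).lipschitzOnWith_of_nnnorm_deriv_le (𝕜 := ℂ)
      (fun w hw => hd.differentiableAt (isOpen_ball.mem_nhds (hsub hw))) fun w hw => ?_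
    rw [← NNReal.coe_le_coe]
    simpa using hder w hw
  have hcontr : ContractingWith (1 / 4) (hmaps.restrict K _ _) :=
    ⟨by
      rw [← NNReal.coe_lt_coe]
      norm_num, hlip.mapsToRestrict hmaps⟩
  obtain ⟨w, hw, hfix, -⟩ := hcontr.exists_fixedPoint' isClosed_closedBall.isComplete hmaps
    (mem_closedBall_self (x := a) (by positivity)) (edist_ne_top _ _)
  exact ⟨w, hsub hw, hfix, hder w hw⟩

theorem exists_islands_over_triples {f : ℂ → ℂ} (hf : Differentiable ℂ f) {s r : ℝ → ℝ}
    {U : Ultrafilter ℝ} {A : Finset ℂ} (hA : ∀ a ∈ A, Blow U (rescaled f s r) a) (B : Finset ℂ)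
    {ε : ℝ} (hε : 0 < ε) :
    ∃ σ > 0, σ < 1 / 4 ∧ ∀ᶠ R in (U : Filter ℝ), ∀ T ∈ B.powersetCard 3, ∀ a ∈ A, ∃ b ∈ T,
      ∃ h : ℂ → ℂ, DifferentiableOn ℂ h (ball b σ) ∧
        ∀ v ∈ ball b σ, h v ∈ ball a ε ∧ rescaled f s r R (h v) = v := by
  have h1 : ∀ᶠ σ in 𝓝[>] (0 : ℝ), ∀ T ∈ B.powersetCard 3, ∀ᶠ R in (U : Filter ℝ), ∀ a ∈ A,
      ∃ b ∈ T, ∃ h : ℂ → ℂ, DifferentiableOn ℂ h (ball b σ) ∧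
        ∀ v ∈ ball b σ, h v ∈ ball a ε ∧ rescaled f s r R (h v) = v := by
    rw [Filter.eventually_all_finset]
    intro T hT
    obtain ⟨δ, hδ, H⟩ := exists_island_near_blow (Finset.mem_powersetCard.1 hT).2
    filter_upwards [Ioo_mem_nhdsGT hδ] with σ hσ
    rw [Filter.eventually_all_finset]
    intro a ha
    filter_upwards [H (differentiable_rescaled hf s r) (hA a ha) hε] with R hR
    obtain ⟨b, hb, h, hd, hh⟩ := hR
    have hsub := ball_subset_ball (x := b) hσ.2.le
    exact ⟨b, hb, h, hd.mono hsub, fun v hv => hh v (hsub hv)⟩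
  obtain ⟨σ, h2, hσ⟩ := (h1.and (Ioo_mem_nhdsGT (show (0 : ℝ) < 1 / 4 by norm_num))).exists
  exact ⟨σ, hσ.1, hσ.2, (Filter.eventually_all_finset _).2 h2⟩

theorem norm_deriv_iterate_of_islands {F h h' : ℂ → ℂ} (hF : Differentiable ℂ F) {a b w : ℂ}
    {δ σ : ℝ} {r : ℂ} (hr : r ≠ 0) (hd : DifferentiableOn ℂ h (ball a δ))
    (hd' : DifferentiableOn ℂ h' (ball b σ)) (hw : w ∈ ball a δ) (hv : h w ∈ ball b σ)
    (hfix : h' (h w) = w) (hFh : ∀ v ∈ ball b σ, F (r * h (h' v)) = r * v)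
    (hder : ‖deriv (fun u => h' (h u)) w‖ ≤ 1 / 4) : 1 < ‖deriv F (r * h w)‖ := by
  have e1 : HasDerivAt h (deriv h w) w :=
    (hd.differentiableAt (isOpen_ball.mem_nhds hw)).hasDerivAt
  have e2 : HasDerivAt h' (deriv h' (h w)) (h w) :=
    (hd'.differentiableAt (isOpen_ball.mem_nhds hv)).hasDerivAt
  have e3 : HasDerivAt (fun u => h' (h u)) (deriv h' (h w) * deriv h w) w := e2.comp w e1
  rw [e3.deriv] at hder
  have e4 : HasDerivAt (fun u => h (h' u)) (deriv h w * deriv h' (h w)) (h w) :=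
    HasDerivAt.comp (h w) (by rwa [hfix]) e2
  have e5 : HasDerivAt F (deriv F (r * h w)) (r * h (h' (h w))) := by
    rw [hfix]
    exact (hF _).hasDerivAt
  have e6 : HasDerivAt (fun u => F (r * h (h' u)))
      (deriv F (r * h w) * (r * (deriv h w * deriv h' (h w)))) (h w) :=
    HasDerivAt.comp (h w) e5 (e4.const_mul r)
  have e7 : HasDerivAt (fun u => F (r * h (h' u))) (r * 1) (h w) :=
    ((hasDerivAt_id (h w)).const_mul r).congr_of_eventuallyEq
      ((isOpen_ball.eventually_mem hv).mono fun v hv => hFh v hv)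
  have e8 : deriv F (r * h w) * (deriv h' (h w) * deriv h w) = 1 := by
    have := e6.unique e7
    apply mul_left_cancel₀ hr
    rw [← this]
    ring
  have e9 := congrArg norm e8
  rw [norm_mul, norm_one] at e9
  nlinarith [norm_nonneg (deriv F (r * h w))]

theorem exists_repelling_of_covers {f : ℂ → ℂ} (hf : Differentiable ℂ f) {x : ℝ → ℂ}
    (hx : IsExtremal f x) {m : ℕ} {U : Ultrafilter ℝ} (hU : (U : Filter ℝ) ≤ atTop)
    {A : Finset ℂ} (hA : ∀ a ∈ A, Blow U (rescaled f id (fun R => ‖x R‖)^[m]) a)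
    (hcov : Covers f (‖x ·‖) U A m) (M : ℝ) :
    ∃ z, M < ‖z‖ ∧ f^[m + 1] z = z ∧ (∀ j, 1 ≤ j → j < m + 1 → f^[j] z ≠ z) ∧
      1 < ‖deriv (f^[m + 1]) z‖ := by
  obtain ⟨B, hB, hBn, δ, hδ, hcov⟩ := hcov (A.card * 2 + 1)
  obtain ⟨σ, hσ, hσ4, htri⟩ := exists_islands_over_triples hf hA B (ε := δ / 8) (by positivity)
  have hrt := (hx.tendsto_iterate m).mono_left hU
  obtain ⟨R, h1, h2, h3⟩ := ((hcov σ hσ).and (htri.and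
    (hrt.eventually_gt_atTop (4 * max M 0)))).exists
  set r : ℝ := (fun R => ‖x R‖)^[m] R
  have hr0 : 0 < r := by linarith [le_max_right M 0]
  have hrM : 4 * M < r := by linarith [le_max_left M 0]
  have hrC : (r : ℂ) ≠ 0 := by exact_mod_cast hr0.ne'
  choose! α hα h hd hh using h1
  obtain ⟨a, ha, hcard⟩ := Finset.exists_lt_card_fiber_of_mul_lt_card_of_maps_to (n := 2) hα
    (by omega)
  obtain ⟨T, hT, hT3⟩ := Finset.exists_subset_card_eq (Nat.succ_le_of_lt hcard)
  obtain ⟨b, hb, h', hd', hh'⟩ := h2 T (Finset.mem_powersetCard.2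
    ⟨hT.trans (Finset.filter_subset _ _), hT3⟩) a ha
  obtain ⟨hbB, hba⟩ := Finset.mem_filter.1 (hT hb)
  have hdb := hd b hbB
  have hhb := hh b hbB
  rw [hba] at hdb hhb
  obtain ⟨w, hw, hfix, hder⟩ := exists_fixedPt_of_mapsTo_ball (K := fun u => h' (h b u)) hδ
    (hd'.comp hdb fun u hu => (hhb u hu).1) fun u hu => (hh' _ (hhb u hu).1).1
  obtain ⟨hv, hfm, hmod⟩ := hhb w hw
  have hdrop : ∀ v ∈ ball b σ, f (R * h' v) = r * v := fun v hv => by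
    have := (hh' v hv).2
    rw [rescaled, div_eq_iff hrC] at this
    rw [mul_comm (r : ℂ), ← this]
    rfl
  have hF : ∀ v ∈ ball b σ, f^[m + 1] (r * h b (h' v)) = r * v := fun v hv => by
    have h4 : h' v ∈ ball a δ := ball_subset_ball (by linarith) (hh' v hv).1
    rw [Function.iterate_succ_apply', (hhb _ h4).2.1, hdrop v hv]
  refine ⟨r * h b w, ?_, ?_, fun j hj1 hj2 heq => ?_, ?_⟩
  · rw [norm_mul, Complex.norm_real, Real.norm_of_nonneg hr0.le]
    have h5 : 1 / 4 < ‖h b w‖ := by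
      rw [mem_ball, dist_eq_norm] at hv
      linarith [norm_sub_norm_le b (h b w), norm_sub_rev b (h b w), (hBn b hbB).1]
    nlinarith
  · have := hF _ hv
    rwa [hfix] at this
  · have := hmod j hj1 (by omega)
    rw [heq] at this
    exact lt_irrefl _ this
  · exact norm_deriv_iterate_of_islands (hf.iterate (m + 1)) hrC hdb hd' hw hv hfix hF hder

end

/-- Bergweiler's theorem: an entire transcendental function has infinitely many
repelling periodic points of any minimal period `n ≥ 2`. -/
theorem entire_transcendental_repelling_periodic_points
    (f : ℂ → ℂ)
    (hf : Differentiable ℂ f)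
    (htrans : ¬ ∃ p : Polynomial ℂ, ∀ z : ℂ, f z = p.eval z)
    (n : ℕ) (hn : 2 ≤ n) :
    {z : ℂ | f^[n] z = z ∧ (∀ j, 1 ≤ j → j < n → f^[j] z ≠ z) ∧
      1 < ‖deriv (f^[n]) z‖}.Infinite := by
  obtain ⟨m, rfl⟩ : ∃ m, n = m + 1 := ⟨n - 1, by omega⟩
  obtain ⟨x, hx⟩ := exists_extremal_points hf htrans
  obtain ⟨U, hU, A, hA, hcov⟩ := exists_covers hf htrans hx (m := m) (by omega)
  intro hfin
  obtain ⟨M, hM⟩ := hfin.isBounded.exists_norm_le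
  obtain ⟨z, hzM, hz⟩ := exists_repelling_of_covers hf hx hU hA hcov M
  exact absurd (hM z hz) (not_le.2 hzM)
end

section
/- Let f : ℂ → ℂ be an entire transcendental function (differentiable on all of ℂ and not a polynomial) with finitely many singular values, in the sense that there exists a finite set S ⊆ ℂ such that the restriction of f to ℂ \ f⁻¹(S) is an unbranched covering map onto ℂ \ S. Then f has infinitely many repelling fixed points: the set {z : ℂ | f z = z ∧ ‖deriv f z‖ > 1} is infinite. -/
namespace ExpLift

open Set Filter Topology Metric

/-- A version of Bloch's theorem with an explicit, non-optimal constant. -/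
theorem exists_ball_subset_image {F : ℂ → ℂ} {w : ℂ} {r : ℝ} (hr : 0 < r)
    (hF : DifferentiableOn ℂ F (ball w r)) (hw : deriv F w ≠ 0) :
    ∃ c, ball c (r * ‖deriv F w‖ / 128) ⊆ F '' ball w r := by
  have hsub : closedBall w (r / 2) ⊆ ball w r := closedBall_subset_ball (by linarith)
  have hF' : DifferentiableOn ℂ (deriv F) (ball w r) := hF.deriv isOpen_ball
  obtain ⟨a, ha, hmax⟩ := (isCompact_closedBall w (r / 2)).exists_isMaxOn
    ⟨w, mem_closedBall_self (by linarith)⟩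
    (f := fun z ↦ (r / 2 - dist z w) * ‖deriv F z‖)
    ((Continuous.continuousOn (by fun_prop)).mul (hF'.continuousOn.mono hsub).norm)
  have hmax' : ∀ z ∈ closedBall w (r / 2),
      (r / 2 - dist z w) * ‖deriv F z‖ ≤ (r / 2 - dist a w) * ‖deriv F a‖ := fun z hz ↦ hmax hz
  have hw0 : 0 < ‖deriv F w‖ := norm_pos_iff.2 hw
  have h1 : r / 2 * ‖deriv F w‖ ≤ (r / 2 - dist a w) * ‖deriv F a‖ := by
    simpa using hmax' w (mem_closedBall_self (by linarith))
  set M := ‖deriv F a‖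
  set s := (r / 2 - dist a w) / 2 with hs
  have ha' : dist a w ≤ r / 2 := ha
  have hs0 : 0 < s := by
    have : 0 < (r / 2 - dist a w) * M := lt_of_lt_of_le (by positivity) h1
    have := pos_of_mul_pos_left this (norm_nonneg _)
    simpa [hs] using this
  have hM0 : 0 < M := by
    have : 0 < (r / 2 - dist a w) * M := lt_of_lt_of_le (by positivity) h1
    exact pos_of_mul_pos_right this (by linarith)
  have hball : ball a s ⊆ ball w r := fun z hz ↦ by
    have := dist_triangle z a w
    rw [mem_ball] at *
    have := dist_nonneg (x := a) (y := w)
    linarith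
  have hbd : ∀ z ∈ ball a s, ‖deriv F z‖ ≤ 2 * M := fun z hz ↦ by
    have h := dist_triangle z a w
    rw [mem_ball] at hz
    have h2 := hmax' z (by rw [mem_closedBall]; linarith)
    have h3 : s * ‖deriv F z‖ ≤ (r / 2 - dist z w) * ‖deriv F z‖ := by
      gcongr
      linarith
    have h4 : (r / 2 - dist a w) * M = s * (2 * M) := by rw [hs]; ring
    exact le_of_mul_le_mul_left (by linarith) hs0
  have hlip : ∀ z ∈ ball a s, ‖deriv F z - deriv F a‖ ≤ 4 * M / s * dist z a := fun z hz ↦ by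
    rw [← dist_eq_norm]
    refine Complex.dist_le_div_mul_dist_of_mapsTo_ball (hF'.mono hball) (fun u hu ↦ ?_) hz
    rw [mem_closedBall, dist_eq_norm]
    exact (norm_sub_le _ _).trans (by linarith [hbd u hu])
  have hsub' : closedBall a (s / 8) ⊆ ball a s := closedBall_subset_ball (by linarith)
  have hdiff : ∀ z ∈ ball a s, DifferentiableAt ℂ F z := fun z hz ↦
    hF.differentiableAt (isOpen_ball.mem_nhds (hball hz))
  have happ : ∀ z ∈ closedBall a (s / 8),
      ‖F z - F a - deriv F a * (z - a)‖ ≤ M / 2 * ‖z - a‖ := fun z hz ↦ by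
    have key := (convex_closedBall a (s / 8)).norm_image_sub_le_of_norm_hasDerivWithin_le
      (f := fun u ↦ F u - deriv F a * u) (f' := fun u ↦ deriv F u - deriv F a * 1) (C := M / 2)
      (fun u hu ↦ (((hdiff u (hsub' hu)).hasDerivAt).sub
        ((hasDerivAt_id u).const_mul _)).hasDerivWithinAt)
      (fun u hu ↦ ?_) (mem_closedBall_self (by linarith)) hz
    · exact (congrArg norm (by ring)).trans_le key
    · rw [mul_one]
      refine (hlip u (hsub' hu)).trans ?_
      rw [mem_closedBall] at hu
      calc 4 * M / s * dist u a ≤ 4 * M / s * (s / 8) := by gcongr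
        _ = M / 2 := by field_simp; norm_num
  have hsphere : ∀ z ∈ sphere a (s / 8), M * s / 16 ≤ ‖F z - F a‖ := fun z hz ↦ by
    have h2 := happ z (sphere_subset_closedBall hz)
    have h3 : ‖z - a‖ = s / 8 := by rwa [mem_sphere, dist_eq_norm] at hz
    have h4 : ‖deriv F a * (z - a)‖ = M * (s / 8) := by rw [norm_mul, h3]
    have h5 := norm_sub_norm_le (deriv F a * (z - a)) (deriv F a * (z - a) - (F z - F a))
    rw [sub_sub_cancel, norm_sub_rev _ (F z - F a), h4] at h5
    rw [h3] at h2
    linarith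
  have hne : ∃ᶠ z in 𝓝 a, F z ≠ F a :=
    (((hdiff a (mem_ball_self hs0)).hasDerivAt.eventually_ne
      (norm_pos_iff.1 hM0)).frequently).filter_mono nhdsWithin_le_nhds
  have himg := DiffContOnCl.ball_subset_image_closedBall (r := s / 8)
    (DifferentiableOn.diffContOnCl_ball (U := closedBall a (s / 8)) (fun z hz ↦
      (hdiff z (hsub' hz)).differentiableWithinAt) subset_rfl) (by linarith) hsphere hne
  refine ⟨F a, (ball_subset_ball ?_).trans (himg.trans (image_mono (hsub'.trans hball)))⟩
  have h4 : (r / 2 - dist a w) * M = s * (2 * M) := by rw [hs]; ring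
  linarith

/-- An entire function of polynomial growth is a polynomial. -/
theorem exists_polynomial_of_growth {f : ℂ → ℂ} (hf : Differentiable ℂ f) {C R : ℝ} {m : ℕ}
    (hC : ∀ z, R ≤ ‖z‖ → ‖f z‖ ≤ C * ‖z‖ ^ m) :
    ∃ p : Polynomial ℂ, ∀ z, f z = p.eval z := by
  have hzero : ∀ n, m < n → iteratedDeriv n f 0 = 0 := fun n hn ↦ by
    have hlim : Tendsto (fun r : ℝ ↦ n.factorial * C / r ^ (n - m)) atTop (𝓝 0) :=
      tendsto_const_nhds.div_atTop (tendsto_pow_atTop (by omega))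
    refine norm_le_zero_iff.1 (ge_of_tendsto hlim ?_)
    filter_upwards [eventually_ge_atTop R, eventually_gt_atTop 0] with r hr hr0
    have := Complex.norm_iteratedDeriv_le_of_forall_mem_sphere_norm_le n hr0
      (hf.diffContOnCl (s := ball 0 r)) (C := C * r ^ m) fun z hz ↦ by
        have hz' : ‖z‖ = r := by simpa using hz
        simpa [hz'] using hC z (hz' ▸ hr)
    refine this.trans_eq ?_
    obtain ⟨k, rfl⟩ := Nat.exists_eq_add_of_lt hn
    rw [show m + k + 1 - m = k + 1 by omega, add_assoc, pow_add]
    field_simp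
  refine ⟨∑ n ∈ Finset.range (m + 1),
    Polynomial.C ((n.factorial : ℂ)⁻¹ * iteratedDeriv n f 0) * Polynomial.X ^ n, fun z ↦ ?_⟩
  rw [← Complex.taylorSeries_eq_of_entire' 0 z hf, tsum_eq_sum (s := Finset.range (m + 1))]
  · simp [Polynomial.eval_finsetSum]
  · intro n hn
    rw [hzero n (by simpa using hn)]
    simp

/-- A continuous lift of `exp` through `f` over the half-plane `ρ < re w`. -/
structure IsExpLift (f : ℂ → ℂ) (ρ : ℝ) (g : ℂ → ℂ) : Prop where
  continuousOn : ContinuousOn g {w | ρ < w.re}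
  comp : ∀ w : ℂ, ρ < w.re → f (g w) = Complex.exp w

theorem isOpen_halfPlane (ρ : ℝ) : IsOpen {w : ℂ | ρ < w.re} :=
  isOpen_lt continuous_const Complex.continuous_re

theorem convex_halfPlane (ρ : ℝ) : Convex ℝ {w : ℂ | ρ < w.re} :=
  convex_halfSpace_re_gt ρ

theorem isSimplyConnected_halfPlane (ρ : ℝ) : IsSimplyConnected {w : ℂ | ρ < w.re} := by
  have := (convex_halfPlane ρ).contractibleSpace ⟨((ρ + 1 : ℝ) : ℂ), by simp⟩
  exact (inferInstance : SimplyConnectedSpace {w : ℂ | ρ < w.re})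

/-- A continuous local solution `u` of `p ∘ u = q` is differentiable where `p' ∘ u ≠ 0`. -/
theorem differentiableAt_of_comp {p u q : ℂ → ℂ} {w : ℂ} (hp : Differentiable ℂ p)
    (hu : ContinuousAt u w) (hq : DifferentiableAt ℂ q w) (hpu : ∀ᶠ z in 𝓝 w, p (u z) = q z)
    (hne : deriv p (u w) ≠ 0) : DifferentiableAt ℂ u w := by
  have hs : HasStrictDerivAt p (deriv p (u w)) (u w) :=
    (hp.analyticAt (u w)).hasStrictDerivAt
  have hL := (hs.to_localInverse hne).hasDerivAt.differentiableAt
  rw [hpu.self_of_nhds] at hL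
  refine (hL.comp w hq).congr_of_eventuallyEq ?_
  filter_upwards [hu.eventually (hs.eventually_left_inverse hne), hpu] with z hz hz'
  rw [Function.comp_apply, ← hz', hz]

/-- An entire function is injective near a point where its derivative does not vanish. -/
theorem exists_injOn {f : ℂ → ℂ} (hf : Differentiable ℂ f) {a : ℂ}
    (ha : deriv f a ≠ 0) : ∃ U ∈ 𝓝 a, InjOn f U := by
  have hs : HasStrictDerivAt f (deriv f a) a := (hf.analyticAt a).hasStrictDerivAt
  refine ⟨_, hs.eventually_left_inverse ha, fun x hx y hy hxy ↦ ?_⟩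
  rw [← show _ = x from hx, ← show _ = y from hy, hxy]

namespace IsExpLift

variable {f g g₁ g₂ : ℂ → ℂ} {ρ : ℝ}

theorem continuousAt (hg : IsExpLift f ρ g) {w : ℂ} (hw : ρ < w.re) : ContinuousAt g w :=
  hg.continuousOn.continuousAt ((isOpen_halfPlane ρ).mem_nhds hw)

theorem eventually_comp (hg : IsExpLift f ρ g) {w : ℂ} (hw : ρ < w.re) :
    ∀ᶠ z in 𝓝 w, f (g z) = Complex.exp z := by
  filter_upwards [(isOpen_halfPlane ρ).mem_nhds hw] with z hz using hg.comp z hz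

theorem differentiableAt (hf : Differentiable ℂ f) (hg : IsExpLift f ρ g) {w : ℂ}
    (hw : ρ < w.re) : DifferentiableAt ℂ g w := by
  have hexp : ∀ w : ℂ, ∀ᶠ z in 𝓝[≠] w, Complex.exp z ≠ Complex.exp w := fun w ↦
    (Complex.hasDerivAt_exp w).eventually_ne (Complex.exp_ne_zero w)
  have hfd : AnalyticOnNhd ℂ (deriv f) univ := fun z _ ↦ (hf.analyticAt z).deriv
  have hmain : ∀ᶠ z in 𝓝 (g w), z ≠ g w → deriv f z ≠ 0 := by
    refine eventually_nhdsWithin_iff.1 <|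
      (hfd (g w) trivial).eventually_eq_zero_or_eventually_ne_zero.resolve_left fun h ↦ ?_
    have h0 : ∀ z, deriv f z = 0 := fun z ↦
      hfd.eqOn_zero_of_preconnected_of_eventuallyEq_zero isPreconnected_univ trivial h trivial
    obtain ⟨z, hz1, hz2⟩ := ((hexp w).and (nhdsWithin_le_nhds (hg.eventually_comp hw))).exists
    rw [← hz2, ← hg.comp w hw] at hz1
    exact hz1 (is_const_of_deriv_eq_zero hf h0 _ _)
  refine (Complex.analyticAt_of_differentiable_on_punctured_nhds_of_continuousAt ?_
    (hg.continuousAt hw)).differentiableAt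
  filter_upwards [hexp w, nhdsWithin_le_nhds ((hg.continuousAt hw).eventually hmain),
    nhdsWithin_le_nhds ((isOpen_halfPlane ρ).mem_nhds hw)] with z hz1 hz2 hz3
  refine differentiableAt_of_comp hf (hg.continuousAt hz3)
    Complex.differentiable_exp.differentiableAt (hg.eventually_comp hz3) (hz2 fun h ↦ hz1 ?_)
  rw [← hg.comp z hz3, ← hg.comp w hw, h]

theorem deriv_mul_deriv (hf : Differentiable ℂ f) (hg : IsExpLift f ρ g) {w : ℂ}
    (hw : ρ < w.re) : deriv f (g w) * deriv g w = Complex.exp w := by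
  have h1 := (hf (g w)).hasDerivAt.comp w (hg.differentiableAt hf hw).hasDerivAt
  exact (h1.congr_of_eventuallyEq ((hg.eventually_comp hw).mono fun z hz ↦ hz.symm)).unique
    (Complex.hasDerivAt_exp w)

theorem deriv_comp_ne_zero (hf : Differentiable ℂ f) (hg : IsExpLift f ρ g) {w : ℂ}
    (hw : ρ < w.re) : deriv f (g w) ≠ 0 :=
  left_ne_zero_of_mul (hg.deriv_mul_deriv hf hw ▸ Complex.exp_ne_zero w)

theorem eqOn (hf : Differentiable ℂ f) (h₁ : IsExpLift f ρ g₁) (h₂ : IsExpLift f ρ g₂) {w : ℂ}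
    (hw : ρ < w.re) (h : g₁ w = g₂ w) : EqOn g₁ g₂ {w | ρ < w.re} := by
  obtain ⟨U, hU, hinj⟩ := exists_injOn hf (h₁.deriv_comp_ne_zero hf hw)
  have hd : ∀ {g}, IsExpLift f ρ g → AnalyticOnNhd ℂ g {w | ρ < w.re} := fun hg ↦
    DifferentiableOn.analyticOnNhd
      (fun z hz ↦ (hg.differentiableAt hf hz).differentiableWithinAt) (isOpen_halfPlane ρ)
  refine (hd h₁).eqOn_of_preconnected_of_eventuallyEq (hd h₂)
    (convex_halfPlane ρ).isPreconnected hw ?_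
  filter_upwards [(h₁.continuousAt hw).preimage_mem_nhds hU,
    (h₂.continuousAt hw).preimage_mem_nhds (h ▸ hU), h₁.eventually_comp hw,
    h₂.eventually_comp hw] with z hz1 hz2 hz3 hz4
  exact hinj hz1 hz2 (hz3.trans hz4.symm)

theorem comp_add_int (hg : IsExpLift f ρ g) (m : ℤ) :
    IsExpLift f ρ fun w ↦ g (w + m * (2 * Real.pi * Complex.I)) where
  continuousOn := hg.continuousOn.comp (by fun_prop) fun w hw ↦ by simpa using hw
  comp w hw := by
    rw [hg.comp _ (by simpa using hw), Complex.exp_periodic.int_mul m w]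

/-- A holomorphic logarithm of a nonvanishing lift. -/
theorem exists_log (hf : Differentiable ℂ f) (hg : IsExpLift f ρ g)
    (h0 : ∀ w, ρ < w.re → g w ≠ 0) :
    ∃ φ : ℂ → ℂ, ∀ w, ρ < w.re → DifferentiableAt ℂ φ w ∧ Complex.exp (φ w) = g w := by
  obtain ⟨φ, hφc, hφ⟩ := Complex.exists_continuousOn_eqOn_exp_comp
    (isSimplyConnected_halfPlane ρ) (isOpen_halfPlane ρ) hg.continuousOn
    (by rintro ⟨w, hw, hw0⟩; exact h0 w hw hw0)
  refine ⟨φ, fun w hw ↦ ⟨?_, hφ hw⟩⟩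
  have hw' := (isOpen_halfPlane ρ).mem_nhds hw
  refine differentiableAt_of_comp Complex.differentiable_exp (hφc.continuousAt hw')
    (hg.differentiableAt hf hw) ?_ ?_
  · filter_upwards [hw'] with z hz using hφ hz
  · rw [Complex.deriv_exp]
    exact Complex.exp_ne_zero _

end IsExpLift

/-- Existence of lifts when `f` is a covering over the complement of a small set. -/
theorem exists_isExpLift {f : ℂ → ℂ} {S : Set ℂ} {ρ : ℝ}
    (hcov : IsCoveringMap (fun z : ((f ⁻¹' S)ᶜ : Set ℂ) ↦ (⟨f z, z.2⟩ : (Sᶜ : Set ℂ))))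
    (hS : ∀ s ∈ S, ‖s‖ ≤ Real.exp ρ) {z₀ w₀ : ℂ} (hw₀ : ρ < w₀.re)
    (h : f z₀ = Complex.exp w₀) : ∃ g, IsExpLift f ρ g ∧ g w₀ = z₀ := by
  classical
  have hexp : ∀ w : ℂ, ρ < w.re → Complex.exp w ∉ S := fun w hw hwS ↦ by
    have := hS _ hwS
    rw [Complex.norm_exp, Real.exp_le_exp] at this
    linarith
  have := (isSimplyConnected_halfPlane ρ).simplyConnectedSpace
  have := (isOpen_halfPlane ρ).locallyPathConnectedSpace
  obtain ⟨F, ⟨hF0, hF⟩, -⟩ := hcov.existsUnique_continuousMap_lifts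
    (⟨fun w ↦ ⟨Complex.exp w, hexp w w.2⟩, by fun_prop⟩ : C({w : ℂ | ρ < w.re}, (Sᶜ : Set ℂ)))
    ⟨w₀, hw₀⟩ ⟨z₀, by simpa [h] using hexp w₀ hw₀⟩ (Subtype.ext h)
  refine ⟨fun w ↦ if hw : ρ < w.re then F ⟨w, hw⟩ else 0, ⟨?_, fun w hw ↦ ?_⟩, ?_⟩
  · rw [continuousOn_iff_continuous_domRestrict]
    convert continuous_subtype_val.comp F.continuous using 1
    ext ⟨w, hw⟩
    simp [domRestrict, show ρ < w.re from hw]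
  · have := congrArg Subtype.val (congrFun hF ⟨w, hw⟩)
    simpa [hw] using this
  · simp [hw₀, hF0]

namespace IsExpLift

variable {f g : ℂ → ℂ} {ρ : ℝ}

theorem exists_lt_norm (hf : Differentiable ℂ f) (hg : IsExpLift f ρ g) (M : ℝ) :
    ∃ A, ρ < A ∧ ∀ w : ℂ, A ≤ w.re → M < ‖g w‖ := by
  obtain ⟨B, hB⟩ := (isCompact_closedBall (0 : ℂ) M).exists_bound_of_continuousOn
    hf.continuous.continuousOn
  refine ⟨max (ρ + 1) B, lt_max_of_lt_left (by linarith), fun w hw ↦ ?_⟩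
  rw [max_le_iff] at hw
  by_contra! hlt
  have h1 := hB (g w) (by simpa using hlt)
  rw [hg.comp w (by linarith), Complex.norm_exp] at h1
  linarith [Real.add_one_le_exp w.re]

/-- If a lift is periodic, then `f` is a polynomial. -/
theorem exists_polynomial_of_periodic (hf : Differentiable ℂ f) (hg : IsExpLift f ρ g) {m : ℕ}
    (hm : 0 < m)
    (hper : ∀ w : ℂ, ρ < w.re → g (w + m * (2 * Real.pi * Complex.I)) = g w) :
    ∃ p : Polynomial ℂ, ∀ z, f z = p.eval z := by
  classical
  have hm' : (0 : ℝ) < m := mod_cast hm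
  have h2π : 0 < 2 * Real.pi := Real.two_pi_pos
  let L : ℂ → ℂ := fun z ↦ -(2 * Real.pi * Complex.I) * z
  have hLre : ∀ z, (L z).re = 2 * Real.pi * z.im := fun z ↦ by simp [L]
  let F : ℂ → ℂ := fun z ↦ if ρ < (L z).re then (g (L z))⁻¹ else 0
  have hF : Function.Periodic F (m : ℝ) := fun z ↦ by
    have hre : (L (z + (m : ℝ))).re = (L z).re := by simp [hLre]
    by_cases h : ρ < (L z).re
    · have := hper (L (z + (m : ℝ))) (hre ▸ h)
      have hL : L (z + (m : ℝ)) + m * (2 * Real.pi * Complex.I) = L z := by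
        simp only [L]; push_cast; ring
      simp only [F, hre, h, if_true, ← this, hL]
    · simp only [F, hre, h, if_false]
  have hFlarge : ∀ ε : ℝ, 0 < ε → ∀ᶠ z in comap Complex.im atTop,
      ρ < (L z).re ∧ ε⁻¹ < ‖g (L z)‖ := fun ε _ ↦ by
    obtain ⟨A, hA, hA'⟩ := hg.exists_lt_norm hf ε⁻¹
    filter_upwards [preimage_mem_comap (Ici_mem_atTop (A / (2 * Real.pi)))] with z hz
    have hz' : A ≤ (L z).re := by
      rw [hLre, ← div_le_iff₀' h2π]
      exact hz
    exact ⟨hA.trans_le hz', hA' _ hz'⟩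
  have hhol : ∀ᶠ z in comap Complex.im atTop, DifferentiableAt ℂ F z := by
    filter_upwards [hFlarge 1 one_pos] with z hz
    have hgz : g (L z) ≠ 0 := norm_pos_iff.1 ((by norm_num : (0 : ℝ) < 1⁻¹).trans hz.2)
    have hd : DifferentiableAt ℂ (fun z ↦ (g (L z))⁻¹) z :=
      ((hg.differentiableAt hf hz.1).comp z (by fun_prop : DifferentiableAt ℂ L z)).inv hgz
    refine hd.congr_of_eventuallyEq ?_
    have hcont : Continuous fun z ↦ (L z).re := by fun_prop
    filter_upwards [(isOpen_lt continuous_const hcont).mem_nhds hz.1] with u hu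
    exact if_pos hu
  have hzer : Filter.ZeroAtFilter (comap Complex.im atTop) F := by
    refine NormedAddGroup.tendsto_nhds_zero.2 fun ε hε ↦ ?_
    filter_upwards [hFlarge ε hε] with z hz
    simp only [F, hz.1, if_true, norm_inv]
    exact inv_lt_of_inv_lt₀ hε hz.2
  obtain ⟨C, hC⟩ := (Function.Periodic.exp_decay_of_zero_at_inf hm' hF hhol hzer).bound
  obtain ⟨A, hA⟩ : ∃ A : ℝ, ∀ z : ℂ, A ≤ z.im → (ρ < (L z).re ∧ (1 : ℝ)⁻¹ < ‖g (L z)‖) ∧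
      ‖F z‖ ≤ C * ‖Real.exp (-2 * Real.pi * z.im / m)‖ := by
    obtain ⟨s, hs, hs'⟩ := mem_comap.1 ((hFlarge 1 one_pos).and hC)
    obtain ⟨A, hA⟩ := mem_atTop_sets.1 hs
    exact ⟨A, fun z hz ↦ hs' (hA _ hz)⟩
  set Q := Function.Periodic.cuspFunction m F
  have hQ0 : Q 0 = 0 := Function.Periodic.cuspFunction_zero_of_zero_at_inf hm' hzer
  have hQan : AnalyticAt ℂ Q 0 :=
    Complex.analyticAt_of_differentiable_on_punctured_nhds_of_continuousAt
      (Function.Periodic.eventually_differentiableAt_cuspFunction_nhds_ne_zero hm' hF hhol)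
      (Function.Periodic.differentiableAt_cuspFunction_zero hm' hF hhol
        hzer.boundedAtFilter).continuousAt
  have hmap : 𝓝 (Q 0) ≤ map Q (𝓝 0) := by
    refine hQan.eventually_constant_or_nhds_le_map_nhds.resolve_left fun hconst ↦ ?_
    have hlim := Function.Periodic.invQParam_tendsto hm'
    obtain ⟨q, ⟨hq, hq'⟩, hq0⟩ := (((hlim.eventually (hFlarge 1 one_pos)).and
      (nhdsWithin_le_nhds hconst)).and self_mem_nhdsWithin).exists
    rw [hQ0, show Q q = F _ from Function.Periodic.cuspFunction_eq_of_nonzero _ _ hq0] at hq'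
    simp only [F, hq.1, if_true, inv_eq_zero] at hq'
    rw [hq', norm_zero] at hq
    norm_num at hq
  have hV : Q '' ball 0 (Real.exp (-2 * Real.pi * A / m)) ∈ 𝓝 (0 : ℂ) := by
    have := hmap (image_mem_map (ball_mem_nhds 0 (Real.exp_pos (-2 * Real.pi * A / m))))
    rwa [hQ0] at this
  obtain ⟨ε, hε, hεV⟩ := Metric.mem_nhds_iff.1 hV
  refine exists_polynomial_of_growth hf (C := C ^ m) (R := 2 / ε) (m := m) fun z hz ↦ ?_
  have hz0 : 0 < ‖z‖ := (by positivity : 0 < 2 / ε).trans_le hz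
  obtain ⟨q, hq, hqz⟩ := hεV (a := z⁻¹) (by
    rw [mem_ball_zero_iff, norm_inv]
    refine inv_lt_of_inv_lt₀ hε (lt_of_lt_of_le ?_ hz)
    rw [inv_eq_one_div]
    gcongr
    norm_num)
  have hq0 : q ≠ 0 := by
    rintro rfl
    rw [hQ0] at hqz
    exact norm_pos_iff.1 hz0 (inv_eq_zero.1 hqz.symm)
  set ζ := Function.Periodic.invQParam m q
  have hqζ : Function.Periodic.qParam m ζ = q := Function.Periodic.qParam_right_inv hm'.ne' hq0
  rw [← hqζ, mem_ball_zero_iff, Function.Periodic.norm_qParam_lt_iff hm'] at hq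
  obtain ⟨⟨h1, -⟩, h2⟩ := hA ζ hq.le
  have hFz : F ζ = z⁻¹ := by
    rw [← hqz]
    exact (Function.Periodic.cuspFunction_eq_of_nonzero _ _ hq0).symm
  have hgz : g (L ζ) = z := by
    simp only [F, h1, if_true] at hFz
    exact inv_injective hFz
  rw [hFz, norm_inv, Real.norm_of_nonneg (Real.exp_pos _).le] at h2
  rw [← hgz, hg.comp _ h1, hgz, Complex.norm_exp, hLre, ← mul_pow]
  have h3 : Real.exp (2 * Real.pi * ζ.im / m) ≤ C * ‖z‖ := by
    have h4 : -2 * Real.pi * ζ.im / m = -(2 * Real.pi * ζ.im / m) := by ring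
    rw [h4, Real.exp_neg, inv_le_iff_one_le_mul₀ hz0] at h2
    have h5 := Real.exp_pos (2 * Real.pi * ζ.im / m)
    have h6 : C * (Real.exp (2 * Real.pi * ζ.im / m))⁻¹ * ‖z‖ * Real.exp (2 * Real.pi * ζ.im / m)
        = C * ‖z‖ := by field_simp
    nlinarith
  calc Real.exp (2 * Real.pi * ζ.im) = Real.exp (2 * Real.pi * ζ.im / m) ^ m := by
        rw [← Real.exp_nat_mul]
        congr 1
        field_simp
    _ ≤ (C * ‖z‖) ^ m := by gcongr

/-- Lifts through a transcendental entire function are injective. -/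
theorem injOn (hf : Differentiable ℂ f) (hpoly : ¬ ∃ p : Polynomial ℂ, ∀ z, f z = p.eval z)
    (hg : IsExpLift f ρ g) : InjOn g {w | ρ < w.re} := by
  have key : ∀ {w₁ w₂ : ℂ} {n : ℤ}, ρ < w₁.re → ρ < w₂.re → g w₁ = g w₂ →
      w₁ = w₂ + n * (2 * Real.pi * Complex.I) → n ≤ 0 := by
    intro w₁ w₂ n h₁ h₂ h hn
    by_contra! hpos
    lift n to ℕ using hpos.le
    refine hpoly (hg.exists_polynomial_of_periodic hf (m := n) (by omega) fun w hw ↦ ?_)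
    exact mod_cast (hg.comp_add_int n).eqOn hf hg h₂ (by rw [← hn, h]) hw
  intro w₁ h₁ w₂ h₂ h
  obtain ⟨n, hn⟩ := Complex.exp_eq_exp_iff_exists_int.1
    (show Complex.exp w₁ = Complex.exp w₂ by rw [← hg.comp w₁ h₁, ← hg.comp w₂ h₂, h])
  have hle := key h₁ h₂ h hn
  have hge := key (n := -n) h₂ h₁ h.symm (by rw [hn]; push_cast; ring)
  obtain rfl : n = 0 := by omega
  simpa using hn

/-- Lifts escape to infinity along vertical lines. -/
theorem eventually_lt_norm (hf : Differentiable ℂ f)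
    (hpoly : ¬ ∃ p : Polynomial ℂ, ∀ z, f z = p.eval z)
    (hlift : ∀ z₀ w₀ : ℂ, ρ < w₀.re → f z₀ = Complex.exp w₀ → ∃ g, IsExpLift f ρ g ∧ g w₀ = z₀)
    (hg : IsExpLift f ρ g) {x : ℝ} (hx : ρ < x) (M : ℝ) :
    ∀ᶠ y : ℝ in atTop, M < ‖g (x + y * Complex.I)‖ := by
  by_contra hcon
  have hre : ∀ y : ℝ, (x + y * Complex.I : ℂ).re = x := fun y ↦ by simp
  have hre' : ∀ y : ℝ, ρ < (x + y * Complex.I : ℂ).re := fun y ↦ by rwa [hre]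
  have hfreq : ∃ᶠ y : ℝ in atTop, g (x + y * Complex.I) ∈ closedBall (0 : ℂ) M :=
    (not_eventually.1 hcon).mono fun y hy ↦ by simpa using hy
  obtain ⟨a, -, ha⟩ := (isCompact_closedBall (0 : ℂ) M).exists_mapClusterPt_of_frequently hfreq
  have hfa : ‖f a‖ = Real.exp x := by
    have hcl : IsClosed {z | ‖f z‖ = Real.exp x} :=
      isClosed_eq hf.continuous.norm continuous_const
    refine hcl.mem_of_mapClusterPt ha (Eventually.of_forall fun y ↦ ?_)
    rw [mem_ofPred_eq, hg.comp _ (hre' y), Complex.norm_exp, hre]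
  have hfa0 : f a ≠ 0 := norm_pos_iff.1 (hfa ▸ Real.exp_pos x)
  obtain ⟨w, hw⟩ : ∃ w, f a = Complex.exp w := ⟨_, (Complex.exp_log hfa0).symm⟩
  have hwx : w.re = x := by rwa [hw, Complex.norm_exp, Real.exp_eq_exp] at hfa
  have hwρ : ρ < w.re := hwx ▸ hx
  obtain ⟨G, hG, hGw⟩ := hlift a w hwρ hw
  have hGan : AnalyticAt ℂ G w :=
    DifferentiableOn.analyticAt (s := {w | ρ < w.re})
      (fun z hz ↦ (hG.differentiableAt hf hz).differentiableWithinAt)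
      ((isOpen_halfPlane ρ).mem_nhds hwρ)
  have hG0 : deriv G w ≠ 0 :=
    right_ne_zero_of_mul (hG.deriv_mul_deriv hf hwρ ▸ Complex.exp_ne_zero w)
  have hV : G '' (ball w 1 ∩ {w | ρ < w.re}) ∈ 𝓝 a := by
    rw [← hGw, ← hGan.hasStrictDerivAt.map_nhds_eq hG0]
    exact image_mem_map (inter_mem (ball_mem_nhds w one_pos) ((isOpen_halfPlane ρ).mem_nhds hwρ))
  have hfreq' := ha.frequently hV
  have key : ∀ y : ℝ, g (x + y * Complex.I) ∈ G '' (ball w 1 ∩ {w | ρ < w.re}) →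
      ∃ n : ℤ, EqOn g (fun u ↦ G (u + n * (2 * Real.pi * Complex.I))) {w | ρ < w.re} ∧
        |y + n * (2 * Real.pi) - w.im| < 1 := by
    rintro y ⟨u, ⟨hu, huρ⟩, hgu⟩
    obtain ⟨n, hn⟩ := Complex.exp_eq_exp_iff_exists_int.1
      (show Complex.exp u = Complex.exp (x + y * Complex.I) by
        rw [← hG.comp u huρ, ← hg.comp _ (hre' y), hgu])
    refine ⟨n, hg.eqOn hf (hG.comp_add_int n) (hre' y) (by rw [← hn, hgu]), ?_⟩
    have h1 := (Complex.abs_im_le_norm (u - w)).trans_lt (by simpa [dist_eq_norm] using hu)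
    have h2 : u.im = y + n * (2 * Real.pi) := by rw [hn]; simp
    rwa [Complex.sub_im, h2] at h1
  obtain ⟨y₁, hy₁⟩ := hfreq'.exists
  obtain ⟨y₂, hy₂, hlt⟩ := (hfreq'.and_eventually (eventually_gt_atTop (y₁ + 2))).exists
  obtain ⟨n₁, hn₁, h₁⟩ := key y₁ hy₁
  obtain ⟨n₂, hn₂, h₂⟩ := key y₂ hy₂
  have hn : (n₁ : ℂ) * (2 * Real.pi * Complex.I) = n₂ * (2 * Real.pi * Complex.I) :=
    add_left_cancel <| hG.injOn hf hpoly (by simpa using hwρ) (by simpa using hwρ)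
      ((hn₁ hwρ).symm.trans (hn₂ hwρ))
  obtain rfl : n₁ = n₂ := by
    simpa using hn
  rw [abs_lt] at h₁ h₂
  linarith

end IsExpLift

/-- A strongly contracting map of a right half-plane has, modulo `2πi`, a fixed point, provided it
moves far to the right along the boundary line. -/
theorem exists_exp_eq_exp {φ : ℂ → ℂ} {x : ℝ}
    (hlip : ∀ u v : ℂ, x ≤ u.re → x ≤ v.re → ‖φ u - φ v‖ ≤ 1 / 2 * ‖u - v‖)
    (hφ : ∀ᶠ y : ℝ in atTop, x ≤ (φ (x + y * Complex.I)).re) :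
    ∃ w : ℂ, x ≤ w.re ∧ Complex.exp (φ w) = Complex.exp w := by
  obtain ⟨Y, hY⟩ := eventually_atTop.1 hφ
  let proj : ℂ → ℂ := fun w ↦ ((max w.re x : ℝ) : ℂ) + w.im * Complex.I
  have hproj : ∀ w, x ≤ (proj w).re := fun w ↦ by simp [proj]
  have hproj_lip : ∀ u v, ‖proj u - proj v‖ ≤ ‖u - v‖ := fun u v ↦ by
    rw [Complex.norm_def, Complex.norm_def, Complex.normSq_apply, Complex.normSq_apply]
    refine Real.sqrt_le_sqrt ?_
    have h := abs_max_sub_max_le_abs u.re v.re x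
    have h2 := mul_self_le_mul_self (abs_nonneg _) h
    rw [abs_mul_abs_self, abs_mul_abs_self] at h2
    simpa [proj] using h2
  set c := (φ x).im
  obtain ⟨k, hk⟩ := exists_nat_gt ((3 / 2 * |Y| + 1 - c) / (2 * Real.pi))
  rw [div_lt_iff₀ Real.two_pi_pos] at hk
  let T : ℂ → ℂ := fun w ↦ φ (proj w) + k * (2 * Real.pi * Complex.I)
  have hT : ContractingWith (1 / 2) T := by
    refine ⟨by norm_num, LipschitzWith.of_dist_le_mul fun u v ↦ ?_⟩
    rw [dist_eq_norm, dist_eq_norm, show T u - T v = φ (proj u) - φ (proj v) by simp [T]]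
    have h := hlip _ _ (hproj u) (hproj v)
    have h2 := hproj_lip u v
    norm_num at h ⊢
    linarith
  obtain ⟨w, hw⟩ : ∃ w, T w = w := ⟨_, hT.fixedPoint_isFixedPt⟩
  have hxw : x ≤ w.re := by
    by_contra! hlt
    have hpw : proj w = x + w.im * Complex.I := by simp [proj, max_eq_right hlt.le]
    have h1 : ‖φ (proj w) - φ x‖ ≤ 1 / 2 * |w.im| := by
      refine (hlip _ _ (hproj w) (by simp)).trans_eq ?_
      simp [hpw]
    have him : (φ (proj w)).im = w.im - k * (2 * Real.pi) := by
      have := congrArg Complex.im hw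
      simp only [T, Complex.add_im, Complex.mul_im] at this
      simp at this
      linarith
    have hre : (φ (proj w)).re = w.re := by
      have := congrArg Complex.re hw
      simpa [T] using this
    have h2 := (Complex.abs_im_le_norm _).trans h1
    rw [Complex.sub_im, him, abs_le] at h2
    have hYw : Y ≤ w.im := by
      rcases abs_cases w.im with h | h <;> rcases abs_cases Y with h' | h' <;> linarith
    have h3 := hY _ hYw
    rw [← hpw, hre] at h3
    linarith
  have hpw : proj w = w := by
    rw [← Complex.re_add_im w]
    simp [proj, hxw]
  refine ⟨w, hxw, ?_⟩
  conv_rhs => rw [← hw]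
  simp only [T, hpw]
  exact (Complex.exp_periodic.nat_mul k _).symm

/-- Logarithms of lifts contract far to the right. -/
theorem norm_deriv_log_le {g φ : ℂ → ℂ} {ρ : ℝ} (hinj : InjOn g {w | ρ < w.re})
    (hφ : ∀ w : ℂ, ρ < w.re → DifferentiableAt ℂ φ w ∧ Complex.exp (φ w) = g w) {w : ℂ}
    (hw : ρ < w.re) : ‖deriv φ w‖ ≤ 384 * Real.pi / (w.re - ρ) := by
  have hr : 0 < w.re - ρ := by linarith
  by_cases h0 : deriv φ w = 0
  · rw [h0, norm_zero]
    have := Real.pi_pos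
    positivity
  have hsub : ball w (w.re - ρ) ⊆ {w | ρ < w.re} := fun z hz ↦ by
    have h1 := (Complex.abs_re_le_norm (z - w)).trans_lt (by simpa [dist_eq_norm] using hz)
    rw [Complex.sub_re, abs_lt] at h1
    rw [mem_ofPred_eq]
    linarith
  obtain ⟨c, hc⟩ := exists_ball_subset_image hr
    (fun z hz ↦ (hφ z (hsub hz)).1.differentiableWithinAt) h0
  by_contra! hlt
  rw [div_lt_iff₀ hr] at hlt
  have hpi := Real.pi_pos
  obtain ⟨u, hu, huc⟩ := hc (mem_ball_self (by nlinarith))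
  obtain ⟨v, hv, hvc⟩ := hc (a := c + 2 * Real.pi * Complex.I) (by
    rw [mem_ball, dist_eq_norm, add_sub_cancel_left]
    simp only [norm_mul, Complex.norm_I, Complex.norm_real, RCLike.norm_ofNat, mul_one,
      Real.norm_of_nonneg hpi.le]
    linarith)
  have huv : u = v := hinj (hsub hu) (hsub hv) (by
    rw [← (hφ u (hsub hu)).2, ← (hφ v (hsub hv)).2, huc, hvc, Complex.exp_periodic])
  rw [huv, hvc] at huc
  simp [Complex.I_ne_zero, hpi.ne'] at huc

end ExpLift

/-- An entire transcendental function with finitely many singular values has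
infinitely many repelling fixed points. -/
theorem entire_finiteSingular_repelling_fixed_points
    (f : ℂ → ℂ)
    (hf : Differentiable ℂ f)
    (htrans : ¬ ∃ p : Polynomial ℂ, ∀ z : ℂ, f z = p.eval z)
    (hsing : ∃ S : Set ℂ, S.Finite ∧
      IsCoveringMap (fun z : ((f ⁻¹' S)ᶜ : Set ℂ) =>
        (⟨f z, z.2⟩ : (Sᶜ : Set ℂ)))) :
    {z : ℂ | f z = z ∧ 1 < ‖deriv f z‖}.Infinite := by
  obtain ⟨S, hSfin, hcov⟩ := hsing
  obtain ⟨B, hB⟩ := hSfin.isBounded.exists_norm_le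
  set ρ := max B ‖f 0‖
  have hρexp : ρ ≤ Real.exp ρ := by linarith [Real.add_one_le_exp ρ]
  have hlift : ∀ z₀ w₀ : ℂ, ρ < w₀.re → f z₀ = Complex.exp w₀ →
      ∃ g, ExpLift.IsExpLift f ρ g ∧ g w₀ = z₀ := fun z₀ w₀ hw₀ h ↦
    ExpLift.exists_isExpLift hcov (fun s hs ↦ ((hB s hs).trans (le_max_left _ _)).trans hρexp) hw₀ h
  obtain ⟨g, hg⟩ : ∃ g, ExpLift.IsExpLift f ρ g := by
    obtain ⟨z₀, hz₀⟩ : ∃ z₀, Real.exp ρ < ‖f z₀‖ := by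
      by_contra! h
      exact htrans (ExpLift.exists_polynomial_of_growth hf (C := Real.exp ρ) (R := 0) (m := 0)
        fun z _ ↦ by simpa using h z)
    have hne : f z₀ ≠ 0 := norm_pos_iff.1 ((Real.exp_pos ρ).trans hz₀)
    obtain ⟨g, hg, -⟩ := hlift z₀ (Complex.log (f z₀))
      (by rwa [Complex.log_re, Real.lt_log_iff_exp_lt (norm_pos_iff.2 hne)])
      (Complex.exp_log hne).symm
    exact ⟨g, hg⟩
  have hinj := hg.injOn hf htrans
  have hg0 : ∀ w : ℂ, ρ < w.re → g w ≠ 0 := fun w hw h ↦ by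
    have h1 := congrArg norm (hg.comp w hw)
    rw [h, Complex.norm_exp] at h1
    linarith [Real.add_one_le_exp w.re, le_max_right B ‖f 0‖]
  obtain ⟨φ, hφ⟩ := hg.exists_log hf hg0
  refine fun hfin ↦ ?_
  obtain ⟨N, hN⟩ := hfin.isBounded.exists_norm_le
  set x := max (ρ + 768 * Real.pi) N
  have hpi := Real.pi_pos
  have hxρ : ρ < x := (by linarith : ρ < ρ + 768 * Real.pi).trans_le (le_max_left _ _)
  have hderiv : ∀ w : ℂ, x ≤ w.re → ‖deriv φ w‖ ≤ 1 / 2 := fun w hw ↦ by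
    have h1 : ρ + 768 * Real.pi ≤ w.re := (le_max_left _ _).trans hw
    refine (ExpLift.norm_deriv_log_le hinj hφ (hxρ.trans_le hw)).trans ?_
    rw [div_le_iff₀ (by linarith)]
    linarith
  obtain ⟨w, hxw, hw⟩ := ExpLift.exists_exp_eq_exp (φ := φ) (x := x)
    (fun u v hu hv ↦ (convex_halfSpace_re_ge x).norm_image_sub_le_of_norm_hasDerivWithin_le
      (fun z hz ↦ (hφ z (hxρ.trans_le hz)).1.hasDerivAt.hasDerivWithinAt)
      (fun z hz ↦ hderiv z hz) hv hu)
    ((hg.eventually_lt_norm hf htrans hlift hxρ (Real.exp x)).mono fun y hy ↦ by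
      rw [← (hφ _ (by simpa using hxρ)).2, Complex.norm_exp, Real.exp_lt_exp] at hy
      exact hy.le)
  have hwρ := hxρ.trans_le hxw
  have hgw : g w = Complex.exp w := by rw [← (hφ w hwρ).2, hw]
  have hgd : deriv g w = Complex.exp w * deriv φ w := by
    rw [← hw]
    refine ((hφ w hwρ).1.hasDerivAt.cexp.congr_of_eventuallyEq ?_).deriv
    filter_upwards [(ExpLift.isOpen_halfPlane ρ).mem_nhds hwρ] with z hz using (hφ z hz).2.symm
  have hmul : deriv f (Complex.exp w) * deriv φ w = 1 := by
    have h := hg.deriv_mul_deriv hf hwρ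
    rw [hgw, hgd] at h
    exact mul_left_cancel₀ (Complex.exp_ne_zero w) (by linear_combination h)
  have hnorm : ‖deriv f (Complex.exp w)‖ * ‖deriv φ w‖ = 1 := by rw [← norm_mul, hmul, norm_one]
  have hfix := hN (Complex.exp w) ⟨by rw [← hgw, hg.comp w hwρ, hgw],
    by nlinarith [hderiv w hxw, norm_nonneg (deriv f (Complex.exp w))]⟩
  rw [Complex.norm_exp] at hfix
  linarith [Real.add_one_le_exp w.re, le_max_right (ρ + 768 * Real.pi) N]
end
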